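/- Let G be a 3-edge-connected and internally 4-edge-connected graph which does not immerse W_4. Then either G is cubic or G has tree-width at most 3. -/

import Mathlib

open scoped Classical

noncomputable section

namespace PaperW4

/-- A finite loopless undirected multigraph on ambient vertex type `V`:
a finite vertex set together with a multiset of (non-loop) edges supported on it. -/
structure MG (V : Type) where
  verts : Finset V
  edges : Multiset (Sym2 V)
  edge_support : ∀ e ∈ edges, ∀ v ∈ e, v ∈ verts
  loopless : ∀ e ∈ edges, ¬ e.IsDiag

variable {V : Type} {W : Type}

/-- `δ_G(X)`: the edges of `G` with exactly one endpoint in `X`. -/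
def cutEdges (G : MG V) (X : Finset V) : Multiset (Sym2 V) :=
  G.edges.filter fun e => ∃ u v, e = s(u, v) ∧ u ∈ X ∧ v ∉ X

/-- `d_G(X) = |δ_G(X)|`. -/
def dcut (G : MG V) (X : Finset V) : ℕ := (cutEdges G X).card

/-- The degree of a vertex: the number of edges incident with it. -/
def deg (G : MG V) (v : V) : ℕ := (G.edges.filter fun e => v ∈ e).card

/-- `e_G(u,v)`: the number of edges joining `u` and `v`. -/
def emult (G : MG V) (u v : V) : ℕ := G.edges.count s(u, v)

/-- `G` is `k`-edge-connected: every edge-cut `δ(X)` with `∅ ≠ X ⊊ V(G)` has size `≥ k`. -/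
def EdgeConn (G : MG V) (k : ℕ) : Prop :=
  ∀ X : Finset V, X ⊆ G.verts → X.Nonempty → X ≠ G.verts → k ≤ dcut G X

/-- `G` is internally `k`-edge-connected: every edge-cut with at least two vertices
on each side has size `≥ k`. -/
def InternallyEdgeConn (G : MG V) (k : ℕ) : Prop :=
  ∀ X : Finset V, X ⊆ G.verts → 2 ≤ X.card → 2 ≤ (G.verts \ X).card → k ≤ dcut G X

/-- Every vertex has degree three. -/
def Cubic (G : MG V) : Prop := ∀ v ∈ G.verts, deg G v = 3

/-- The multiset of edges traversed by a walk, given as its list of vertices. -/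
def walkEdges (l : List V) : Multiset (Sym2 V) :=
  (↑((l.zip l.tail).map fun p => s(p.1, p.2)) : Multiset (Sym2 V))

/-- `l` is (the vertex sequence of) a walk from `u` to `v`. -/
def IsWalk (l : List V) (u v : V) : Prop :=
  l.head? = some u ∧ l.getLast? = some v

/-- `G` is connected: any two of its vertices are joined by a trail in `G`. -/
def Connected (G : MG V) : Prop :=
  ∀ u ∈ G.verts, ∀ v ∈ G.verts,
    ∃ l : List V, IsWalk l u v ∧ walkEdges l ≤ G.edges ∧ ∀ w ∈ l, w ∈ G.verts

/-- An immersion of the loopless multigraph with vertex type `W` and edge multiset `H`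
into `G`, with terminal map `φ`: `φ` is injective, and to each edge `uv` of `H` is
assigned a walk in `G` from `φ u` to `φ v`, these walks being globally edge-disjoint. -/
def ImmersionVia (G : MG V) (H : Multiset (Sym2 W)) (φ : W → V) : Prop :=
  Function.Injective φ ∧ (∀ w : W, φ w ∈ G.verts) ∧
  ∃ P : Multiset (Sym2 W × List V),
    P.map Prod.fst = H ∧
    (∀ p ∈ P, ∃ u v : W, p.1 = s(u, v) ∧ IsWalk p.2 (φ u) (φ v)) ∧
    (P.map fun p => walkEdges p.2).sum ≤ G.edges

/-- The edges of the wheel `W₄`: vertex `0` is the center, `1,2,3,4` the rim cycle. -/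
def w4Edges : Multiset (Sym2 (Fin 5)) :=
  {s(0, 1), s(0, 2), s(0, 3), s(0, 4), s(1, 2), s(2, 3), s(3, 4), s(4, 1)}

/-- `G` has an immersion of `W₄`. -/
def HasW4Immersion (G : MG V) : Prop :=
  ∃ φ : Fin 5 → V, ImmersionVia G w4Edges φ

/-- `G` (rooted at `x`) has a rooted immersion of `W₄`: one in which the
center of `W₄` corresponds to `x`. -/
def HasRootedW4Immersion (G : MG V) (x : V) : Prop :=
  ∃ φ : Fin 5 → V, φ 0 = x ∧ ImmersionVia G w4Edges φ

/-- The edges of `D_m`: roots are `0, 1`; vertices `2, 3` play the role of `y₀, y₁`;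
there are `m - 2` parallel edges between the two roots. -/
def dmEdges (m : ℕ) : Multiset (Sym2 (Fin 4)) :=
  Multiset.replicate (m - 2) s(0, 1) + {s(0, 2), s(0, 3), s(1, 2), s(1, 3), s(2, 3)}

/-- `G` with roots `x0, x1` has a rooted immersion of `D_m`. -/
def HasRootedDmImmersion (G : MG V) (m : ℕ) (x0 x1 : V) : Prop :=
  ∃ φ : Fin 4 → V, φ 0 = x0 ∧ φ 1 = x1 ∧ ImmersionVia G (dmEdges m) φ

/-- The edges of `K₄`. -/
def k4Edges : Multiset (Sym2 (Fin 4)) :=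
  {s(0, 1), s(0, 2), s(0, 3), s(1, 2), s(1, 3), s(2, 3)}

/-- A nested chain of vertex sets `C 0 ⊂ C 1 ⊂ ⋯`, each obtained from the previous
by adding one vertex, all cuts having size exactly `k`. -/
def SegChain (G : MG V) (n : ℕ) (C : Fin (n + 1) → Finset V) (k : ℕ) : Prop :=
  (∀ i, C i ⊆ G.verts) ∧
  (∀ i : Fin n, C i.castSucc ⊆ C i.succ ∧ (C i.succ \ C i.castSucc).card = 1) ∧
  (∀ i, dcut G (C i) = k)

/-- `G` has a segmentation of width `k` relative to `(X, Y)`. -/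
def HasSegmentation (G : MG V) (X Y : Finset V) (k : ℕ) : Prop :=
  ∃ (n : ℕ) (C : Fin (n + 1) → Finset V),
    SegChain G n C k ∧ C 0 = X ∧ G.verts \ C (Fin.last n) = Y

/-- `λ_s(G) ≥ m`: every edge-cut separating `x0` from `x1` has size `≥ m`. -/
def LamSGe (G : MG V) (x0 x1 : V) (m : ℕ) : Prop :=
  ∀ X : Finset V, X ⊆ G.verts → x0 ∈ X → x1 ∉ X → m ≤ dcut G X

/-- `λ_n(G) ≥ m`: every edge-cut not separating `x0` from `x1` has size `≥ m`. -/
def LamNGe (G : MG V) (x0 x1 : V) (m : ℕ) : Prop :=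
  ∀ X : Finset V, X ⊆ G.verts → X.Nonempty → X ≠ G.verts →
    (x0 ∈ X ↔ x1 ∈ X) → m ≤ dcut G X

/-- `λ_n^i(G) ≥ m`: every internal edge-cut not separating `x0` from `x1` has size `≥ m`. -/
def LamNiGe (G : MG V) (x0 x1 : V) (m : ℕ) : Prop :=
  ∀ X : Finset V, X ⊆ G.verts → 2 ≤ X.card → 2 ≤ (G.verts \ X).card →
    (x0 ∈ X ↔ x1 ∈ X) → m ≤ dcut G X

/-- The subgraph of `G` induced on `S`. -/
def induce (G : MG V) (S : Finset V) : MG V where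
  verts := G.verts ∩ S
  edges := G.edges.filter fun e => ∀ v ∈ e, v ∈ S
  edge_support := by
    intro e he v hv
    rw [Multiset.mem_filter] at he
    exact Finset.mem_inter.mpr ⟨G.edge_support e he.1 v hv, he.2 v hv⟩
  loopless := fun e he => G.loopless e (Multiset.mem_of_mem_filter he)

/-- `G` with the vertices of `S` (and all incident edges) deleted. -/
def deleteVerts (G : MG V) (S : Finset V) : MG V := induce G (G.verts \ S)

/-- `C` is (the vertex set of) a connected component of `G`. -/
def IsComponent (G : MG V) (C : Finset V) : Prop :=
  C ⊆ G.verts ∧ C.Nonempty ∧ Connected (induce G C) ∧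
  ∀ e ∈ G.edges, (∃ v ∈ e, v ∈ C) → ∀ v ∈ e, v ∈ C

/-- `G` has type `A_m` with respect to roots `x0, x1`. -/
def TypeA (G : MG V) (m : ℕ) (x0 x1 : V) : Prop :=
  ∃ X0 X1 : Finset V, x0 ∈ X0 ∧ x1 ∈ X1 ∧ X0.card ≤ 2 ∧ X1.card ≤ 2 ∧
    HasSegmentation G X0 X1 m

/-- The edges of the lobe of `G` (with roots `x0, x1`) corresponding to the
component `C` of `G ∖ {x0, x1}`: edges inside `C ∪ {x0, x1}` other than `x0x1`-edges. -/
def lobeEdges (G : MG V) (C : Finset V) (x0 x1 : V) : Multiset (Sym2 V) :=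
  G.edges.filter fun e => (∀ v ∈ e, v ∈ insert x0 (insert x1 C)) ∧ e ≠ s(x0, x1)

/-- `G` has type `B_m` with respect to roots `x0, x1`. -/
def TypeB (G : MG V) (m : ℕ) (x0 x1 : V) : Prop :=
  ∃ (k : ℕ) (C : Fin k → Finset V) (nL : Fin k → ℕ),
    Function.Injective C ∧
    (∀ D : Finset V, IsComponent (deleteVerts G {x0, x1}) D ↔ ∃ i, C i = D) ∧
    (∀ i : Fin k, 2 ≤ nL i ∧
      ∃ l : List V, l.Nodup ∧ IsWalk l x0 x1 ∧
        l.toFinset = insert x0 (insert x1 (C i)) ∧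
        (2 ≤ (C i).card → nL i = 2) ∧
        lobeEdges G (C i) x0 x1 = nL i • walkEdges l) ∧
    emult G x0 x1 + ∑ i, nL i = m + 1

/-- The edge multiset of a cycle of length `n` on the vertices `f 0, f 1, …`. -/
def cycleEdges (n : ℕ) (f : Fin n → V) : Multiset (Sym2 V) :=
  (Finset.univ.val : Multiset (Fin n)).map fun i =>
    s(f i, f ⟨(i.val + 1) % n, Nat.mod_lt _ i.pos⟩)

/-- `G` is a doubled cycle of length `n`. -/
def IsDoubledCycleLen (G : MG V) (n : ℕ) : Prop :=
  ∃ f : Fin n → V, Function.Injective f ∧ Finset.univ.image f = G.verts ∧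
    G.edges = 2 • cycleEdges n f

/-- `G` is a doubled cycle. -/
def IsDoubledCycle (G : MG V) : Prop := ∃ n, 3 ≤ n ∧ IsDoubledCycleLen G n

/-- The map collapsing all of `Y` to the vertex `y0` and fixing everything else. -/
def collapseFun (Y : Finset V) (y0 : V) : V → V := fun v => if v ∈ Y then y0 else v

/-- The image multigraph of `G` under a vertex map `f` (identification of vertices),
with any created loops deleted. -/
def mapGraph (f : V → V) (G : MG V) : MG V where
  verts := G.verts.image f
  edges := (G.edges.map (Sym2.map f)).filter fun e => ¬e.IsDiag
  edge_support := by
    intro e he v hv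
    rw [Multiset.mem_filter] at he
    obtain ⟨he, -⟩ := he
    rw [Multiset.mem_map] at he
    obtain ⟨e', he', rfl⟩ := he
    rw [Sym2.mem_map] at hv
    obtain ⟨u, hu, rfl⟩ := hv
    exact Finset.mem_image_of_mem f (G.edge_support e' he' u hu)
  loopless := by
    intro e he
    rw [Multiset.mem_filter] at he
    exact he.2

/-- `G[X]` is a chain of sausages of order `k` in `G`: identifying `V(G) ∖ X` to a
single vertex yields a doubled cycle of length `k + 1`. -/
def ChainOfSausages (G : MG V) (X : Finset V) (k : ℕ) : Prop :=
  X ⊆ G.verts ∧ X.card = k ∧ 2 ≤ k ∧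
  ∃ y0 ∈ G.verts \ X,
    IsDoubledCycleLen (mapGraph (collapseFun (G.verts \ X) y0) G) (k + 1)

/-- `G` is sausage reduced: it has no chain of sausages of order at least `3`. -/
def SausageReduced (G : MG V) : Prop :=
  ¬ ∃ (X : Finset V) (k : ℕ), 3 ≤ k ∧ ChainOfSausages G X k

/-- One sausage shortening step of a rooted graph: two adjacent vertices of a chain of
sausages of order at least three are identified, carrying the root along. -/
def RootedShortStep (p q : MG V × V) : Prop :=
  ∃ (X : Finset V) (k : ℕ) (a b : V),
    3 ≤ k ∧ ChainOfSausages p.1 X k ∧ a ∈ X ∧ b ∈ X ∧ a ≠ b ∧ s(a, b) ∈ p.1.edges ∧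
    q.1 = mapGraph (fun v => if v = b then a else v) p.1 ∧
    q.2 = (if p.2 = b then a else p.2)

/-- Deleting a single copy of the edge `e` from `G`. -/
def deleteEdge (G : MG V) (e : Sym2 V) : MG V where
  verts := G.verts
  edges := G.edges.erase e
  edge_support := fun e' he' => G.edge_support e' (Multiset.mem_of_mem_erase he')
  loopless := fun e' he' => G.loopless e' (Multiset.mem_of_mem_erase he')

/-- `G` has a tree-decomposition of width at most `k`. -/
def HasTreeDecomp (G : MG V) (k : ℕ) : Prop :=
  ∃ (ι : Type) (T : SimpleGraph ι) (B : ι → Finset V),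
    T.IsTree ∧
    (∀ t, B t ⊆ G.verts) ∧
    (∀ v ∈ G.verts, ∃ t, v ∈ B t) ∧
    (∀ e ∈ G.edges, ∃ t, ∀ v ∈ e, v ∈ B t) ∧
    (∀ v ∈ G.verts, (SimpleGraph.induce {t | v ∈ B t} T).Connected) ∧
    ∀ t, (B t).card ≤ k + 1

/-- The tree-width of `G`. -/
def treewidth (G : MG V) : ℕ := sInf { k | HasTreeDecomp G k }

/-- One subdivision step: an edge `uv` is replaced by a path `u - w - v`
through a new vertex `w`. -/
def SubdivStep (G H : MG V) : Prop :=
  ∃ u v w : V, s(u, v) ∈ G.edges ∧ w ∉ G.verts ∧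
    H.verts = insert w G.verts ∧
    H.edges = (G.edges.erase s(u, v)) + {s(u, w), s(w, v)}

/-- `H` is a subdivision of `G`. -/
def IsSubdivision (G H : MG V) : Prop := Relation.ReflTransGen SubdivStep G H

/-- `G`, rooted at `u`, has type 2 (for the rooted `W₄` theorem). -/
def TypeTwo (G : MG V) (u : V) : Prop :=
  ∃ W0 : Finset V, W0 ⊆ G.verts ∧ u ∉ W0 ∧ 1 ≤ W0.card ∧ W0.card ≤ 2 ∧
    ∃ w0 ∈ W0,
      ∃ n : ℕ, 3 ≤ n ∧
        ∃ f : Fin n → V,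
          Function.Injective f ∧
          Finset.univ.image f = (mapGraph (collapseFun W0 w0) G).verts ∧
          (∃ i, f i = u) ∧ (∃ j, f j = w0) ∧
          ((s(u, w0) ∉ cycleEdges n f ∧
              (mapGraph (collapseFun W0 w0) G).edges =
                2 • cycleEdges n f + {s(u, w0)}) ∨
           (∃ v : V, s(u, v) ∈ cycleEdges n f ∧ s(v, w0) ∈ cycleEdges n f ∧
              (mapGraph (collapseFun W0 w0) G).edges =
                2 • cycleEdges n f + {s(u, v), s(v, w0)}) ∨
           (s(u, w0) ∈ cycleEdges n f ∧
              (mapGraph (collapseFun W0 w0) G).edges =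
                2 • cycleEdges n f + {s(u, w0)}))

/-- `Trail a b E S`: some walk from `a` to `b` traverses exactly the edges in `E` (counted with
multiplicity) and visits exactly the vertices in `S`. -/
inductive Trail : V → V → Multiset (Sym2 V) → Finset V → Prop
  | nil (a : V) : Trail a a 0 {a}
  | cons (a : V) {b c : V} {E : Multiset (Sym2 V)} {S : Finset V} (h : Trail b c E S) :
      Trail a c (s(a, b) ::ₘ E) (insert a S)

theorem add_le_of_disjoint {α : Type} {E F M : Multiset α} (hE : E ≤ M) (hF : F ≤ M)
    (h : ∀ e ∈ E, e ∉ F) : E + F ≤ M := by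
  rw [Multiset.le_iff_count] at *
  intro e
  rw [Multiset.count_add]
  by_cases he : e ∈ E
  · rw [Multiset.count_eq_zero_of_notMem (h e he)]
    exact hE e
  · rw [Multiset.count_eq_zero_of_notMem he, zero_add]
    exact hF e

namespace Trail

variable {a b c : V} {E F : Multiset (Sym2 V)} {S T : Finset V}

theorem left_mem (h : Trail a b E S) : a ∈ S := by
  cases h <;> simp

theorem right_mem (h : Trail a b E S) : b ∈ S := by
  induction h with
  | nil => simp
  | cons a h ih => exact Finset.mem_insert_of_mem ih

theorem mem_of_mem_edge (h : Trail a b E S) {e : Sym2 V} (he : e ∈ E) {v : V} (hv : v ∈ e) :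
    v ∈ S := by
  induction h with
  | nil => simp at he
  | cons a h ih =>
    rcases Multiset.mem_cons.mp he with rfl | he
    · rcases Sym2.mem_iff.mp hv with rfl | rfl
      · simp
      · exact Finset.mem_insert_of_mem h.left_mem
    · exact Finset.mem_insert_of_mem (ih he)

theorem subset (h : Trail a b E S) {U : Finset V} (ha : a ∈ U) (hU : ∀ e ∈ E, ∀ v ∈ e, v ∈ U) :
    S ⊆ U := by
  induction h with
  | nil => simpa using ha
  | cons a h ih =>
    refine Finset.insert_subset ha (ih (hU _ (Multiset.mem_cons_self _ _) _ (by simp)) ?_)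
    exact fun e he => hU e (Multiset.mem_cons_of_mem he)

theorem append (h : Trail a b E S) (h' : Trail b c F T) : Trail a c (E + F) (S ∪ T) := by
  induction h with
  | nil a =>
    rw [zero_add, ← Finset.insert_eq, Finset.insert_eq_self.mpr h'.left_mem]
    exact h'
  | cons a h ih =>
    rw [Multiset.cons_add, Finset.insert_union]
    exact .cons a (ih h')

theorem single (a b : V) : Trail a b {s(a, b)} {a, b} :=
  .cons a (.nil b)

theorem reverse (h : Trail a b E S) : Trail b a E S := by
  induction h with
  | nil a => exact .nil a
  | @cons a b c E S h ih =>
    have := ih.append (single b a)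
    rw [Sym2.eq_swap, add_comm, Multiset.singleton_add] at this
    convert this using 1
    ext v
    have := h.left_mem
    simp only [Finset.mem_insert, Finset.mem_union, Finset.mem_singleton]
    constructor
    · tauto
    · rintro (h | rfl | h) <;> tauto

theorem split (h : Trail a b E S) {r : V} (hr : r ∈ S) :
    ∃ E₁ E₂ S₁ S₂, Trail a r E₁ S₁ ∧ Trail r b E₂ S₂ ∧ E₁ + E₂ = E ∧ S₁ ∪ S₂ = S := by
  induction h with
  | nil a =>
    obtain rfl := Finset.mem_singleton.mp hr
    exact ⟨0, 0, _, _, .nil r, .nil r, by simp, by simp⟩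
  | @cons a b c E S h ih =>
    by_cases hra : r = a
    · subst hra
      exact ⟨0, _, _, _, .nil r, .cons r h, by simp, by simp⟩
    · obtain ⟨E₁, E₂, S₁, S₂, h₁, h₂, rfl, rfl⟩ := ih (Finset.mem_of_mem_insert_of_ne hr hra)
      exact ⟨_, E₂, _, S₂, .cons a h₁, h₂, by simp, by simp⟩

theorem firstHit (h : Trail a b E S) {W : Finset V} (hb : b ∈ W) :
    ∃ p ∈ W, ∃ E' S', Trail a p E' S' ∧ E' ≤ E ∧ S' ⊆ S ∧ ∀ v ∈ S', v ∈ W → v = p := by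
  induction h with
  | nil a => exact ⟨a, hb, 0, _, .nil a, le_rfl, subset_rfl, by simp⟩
  | @cons a b c E S h ih =>
    by_cases ha : a ∈ W
    · exact ⟨a, ha, 0, _, .nil a, zero_le, by simp, by simp⟩
    · obtain ⟨p, hp, E', S', h', hE, hS, hW⟩ := ih hb
      refine ⟨p, hp, _, _, .cons a h', Multiset.cons_le_cons _ hE, Finset.insert_subset_insert _ hS,
        ?_⟩
      intro v hv hvW
      rcases Finset.mem_insert.mp hv with rfl | hv
      · exact absurd hvW ha
      · exact hW v hv hvW

theorem exists_list (h : Trail a b E S) : ∃ l, IsWalk l a b ∧ walkEdges l = E := by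
  induction h with
  | nil a => exact ⟨[a], ⟨rfl, rfl⟩, rfl⟩
  | @cons a b c E S h ih =>
    obtain ⟨l, ⟨hl, hl'⟩, rfl⟩ := ih
    obtain _ | ⟨x, t⟩ := l
    · simp at hl
    · obtain rfl : x = b := by simpa using hl
      exact ⟨a :: x :: t, ⟨rfl, by simpa using hl'⟩, rfl⟩

/-- A trail whose vertices other than its last one avoid `W` shares no edge with a trail
inside `W`. -/
theorem notMem_of_firstHit {p : V} (h : Trail a p E S) {W : Finset V}
    (hW : ∀ v ∈ S, v ∈ W → v = p) {e : Sym2 V} (he : e ∈ E) (hd : ¬ e.IsDiag) :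
    ∃ v ∈ e, v ∉ W := by
  by_contra! hcon
  induction e with | _ x y
  have hx := hW x (h.mem_of_mem_edge he (by simp)) (hcon x (by simp))
  have hy := hW y (h.mem_of_mem_edge he (by simp)) (hcon y (by simp))
  exact hd (by simp [hx, hy])

/-- Realise every edge of a trail by a trail of its own. -/
theorem lift (h : Trail a b E S) {P : Sym2 V → Multiset (Sym2 V)}
    (hP : ∀ x y, s(x, y) ∈ E → ∃ T, Trail x y (P s(x, y)) T) :
    ∃ T, Trail a b (E.map P).sum T ∧ S ⊆ T := by
  induction h with
  | nil a => exact ⟨_, by simpa using .nil a, subset_rfl⟩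
  | @cons a b c E S h ih =>
    obtain ⟨T, hT, hST⟩ := ih fun x y hxy => hP x y (Multiset.mem_cons_of_mem hxy)
    obtain ⟨T', hT'⟩ := hP a b (Multiset.mem_cons_self _ _)
    refine ⟨_, by simpa using hT'.append hT, Finset.insert_subset ?_ ?_⟩
    · exact Finset.mem_union_left _ hT'.left_mem
    · exact hST.trans Finset.subset_union_right

end Trail

/-- `e` has exactly one end in `Z`. -/
def Crosses (Z : Finset V) (e : Sym2 V) : Prop := ∃ u v, e = s(u, v) ∧ u ∈ Z ∧ v ∉ Z

theorem exists_trail {E : Multiset (Sym2 V)} {U W : Finset V}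
    (hU : ∀ e ∈ E, ∀ v ∈ e, v ∈ U) {z : V} (hz : z ∈ U)
    (hcut : ∀ Z ⊆ U, z ∈ Z → Disjoint Z W → ∃ e ∈ E, Crosses Z e) :
    ∃ w ∈ W, ∃ F S, Trail z w F S ∧ F ≤ E := by
  by_contra! hcon
  obtain ⟨e, he, x, y, rfl, hx, hy⟩ := hcut (U.filter fun v => ∃ F S, Trail z v F S ∧ F ≤ E)
    (Finset.filter_subset _ _) (Finset.mem_filter.mpr ⟨hz, 0, _, .nil z, zero_le⟩)
    (Finset.disjoint_left.mpr fun v hv hvW => by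
      obtain ⟨-, F, S, h, hF⟩ := Finset.mem_filter.mp hv
      exact hcon v hvW F S h hF)
  obtain ⟨-, F, S, h, hF⟩ := Finset.mem_filter.mp hx
  refine hy (Finset.mem_filter.mpr ⟨hU _ he _ (by simp), ?_⟩)
  by_cases hyS : y ∈ S
  · obtain ⟨F₁, F₂, S₁, S₂, h₁, -, rfl, -⟩ := h.split hyS
    exact ⟨F₁, S₁, h₁, (Multiset.le_add_right _ _).trans hF⟩
  · refine ⟨_, _, h.append (.single x y), add_le_of_disjoint hF (by simpa using he) ?_⟩
    intro e' he' he''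
    obtain rfl := Multiset.mem_singleton.mp he''
    exact hyS (h.mem_of_mem_edge he' (by simp))

/-- Two edge-disjoint trails to `W` exist as soon as every cut around a set avoiding `W` has at
least two edges. -/
theorem exists_two_trails {E : Multiset (Sym2 V)} {U W : Finset V}
    (hU : ∀ e ∈ E, ∀ v ∈ e, v ∈ U) (hd : ∀ e ∈ E, ¬ e.IsDiag)
    (hcut : ∀ Z ⊆ U, Z.Nonempty → Disjoint Z W → 2 ≤ (E.filter (Crosses Z)).card)
    {z : V} (hz : z ∈ U) :
    ∃ p ∈ W, ∃ q ∈ W, ∃ F₁ F₂ S₁ S₂, Trail z p F₁ S₁ ∧ Trail z q F₂ S₂ ∧ F₁ + F₂ ≤ E := by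
  by_contra hcon
  set D := U.filter fun z => ∃ p ∈ W, ∃ q ∈ W, ∃ F₁ F₂ S₁ S₂,
    Trail z p F₁ S₁ ∧ Trail z q F₂ S₂ ∧ F₁ + F₂ ≤ E with hD
  have hWD : Disjoint (U \ D) W := by
    refine Finset.disjoint_left.mpr fun v hv hvW => ?_
    rw [Finset.mem_sdiff] at hv
    exact hv.2 (Finset.mem_filter.mpr
      ⟨hv.1, v, hvW, v, hvW, 0, 0, _, _, .nil v, .nil v, by simp⟩)
  have hzD : z ∈ U \ D := Finset.mem_sdiff.mpr ⟨hz, fun h => hcon (Finset.mem_filter.mp h).2⟩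
  have h2 := hcut _ Finset.sdiff_subset ⟨z, hzD⟩ hWD
  obtain ⟨e, he⟩ := Multiset.card_pos_iff_exists_mem.mp (two_pos.trans_le h2)
  rw [Multiset.mem_filter] at he
  obtain ⟨he, x, y, rfl, hx, hy⟩ := he
  have hyU : y ∈ U := hU _ he y (by simp)
  have hyD : y ∈ D := by
    by_contra h
    exact hy (Finset.mem_sdiff.mpr ⟨hyU, h⟩)
  rw [Finset.mem_sdiff] at hx
  obtain ⟨hxU, hxD⟩ := hx
  refine hxD (Finset.mem_filter.mpr ⟨hxU, ?_⟩)
  obtain ⟨-, p, hp, q, hq, A, B, SA, SB, hA, hB, hAB⟩ := Finset.mem_filter.mp hyD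
  have hA' := (Multiset.le_add_right A B).trans hAB
  have hB' := (Multiset.le_add_left B A).trans hAB
  by_cases hxA : x ∈ SA
  · obtain ⟨A₁, A₂, S₁, S₂, h₁, h₂, rfl, rfl⟩ := hA.split hxA
    exact ⟨p, hp, q, hq, A₂, _, _, _, h₂, h₁.reverse.append hB,
      le_of_eq_of_le (by abel) hAB⟩
  by_cases hxB : x ∈ SB
  · obtain ⟨B₁, B₂, S₁, S₂, h₁, h₂, rfl, rfl⟩ := hB.split hxB
    exact ⟨q, hq, p, hp, B₂, _, _, _, h₂, h₁.reverse.append hA,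
      le_of_eq_of_le (by abel) hAB⟩
  set W' := SA ∪ SB ∪ W with hW'
  obtain ⟨t₀, ht₀, C₀, S₀, hC₀, hCE₀⟩ := exists_trail (E := E.erase s(x, y)) (U := U) (W := W')
    (fun e he => hU e (Multiset.mem_of_mem_erase he)) hxU (by
      intro Z hZ hxZ hZW
      have h2 := hcut Z hZ ⟨x, hxZ⟩ (hZW.mono_right Finset.subset_union_right)
      have h1 : 0 < ((E.erase s(x, y)).filter (Crosses Z)).card := by
        have := Multiset.card_le_card (Multiset.filter_le_filter (Crosses Z)
          (Multiset.le_cons_erase E s(x, y)))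
        rw [Multiset.filter_cons, Multiset.card_add] at this
        split_ifs at this <;> simp at this <;> omega
      obtain ⟨e, he⟩ := Multiset.card_pos_iff_exists_mem.mp h1
      rw [Multiset.mem_filter] at he
      exact ⟨e, he⟩)
  obtain ⟨t, ht, C, S, hC, hCE, -, hCW⟩ := hC₀.firstHit ht₀
  replace hCE := hCE.trans hCE₀
  have hxe : s(x, y) ::ₘ C ≤ E := by
    rw [← Multiset.cons_erase he]
    exact Multiset.cons_le_cons _ hCE
  have key : s(x, y) ::ₘ C + (A + B) ≤ E := by
    refine add_le_of_disjoint hxe hAB fun e he heAB => ?_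
    have hin : ∀ v ∈ e, v ∈ SA ∪ SB := fun v hv => by
      rcases Multiset.mem_add.mp heAB with h | h
      · exact Finset.mem_union_left _ (hA.mem_of_mem_edge h hv)
      · exact Finset.mem_union_right _ (hB.mem_of_mem_edge h hv)
    rcases Multiset.mem_cons.mp he with rfl | he
    · have := hin x (by simp)
      simp [hxA, hxB] at this
    · obtain ⟨v, hv, hvW⟩ := hC.notMem_of_firstHit hCW he
        (hd _ (Multiset.mem_of_mem_erase (Multiset.mem_of_le hCE he)))
      exact hvW (Finset.mem_union_left _ (hin v hv))
  have hone : ∀ {M M' : Multiset (Sym2 V)}, M' + M = s(x, y) ::ₘ C + (A + B) → M ≤ E :=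
    fun h => ((Multiset.le_add_left _ _).trans h.le).trans key
  rcases Finset.mem_union.mp ht with ht | ht
  · rcases Finset.mem_union.mp ht with ht | ht
    · obtain ⟨A₁, A₂, S₁, S₂, h₁, h₂, rfl, rfl⟩ := hA.split ht
      refine ⟨p, hp, q, hq, _, _, _, _, hC.append h₂, .cons x hB, hone (M' := A₁) ?_⟩
      rw [Multiset.cons_add, Multiset.add_cons, Multiset.add_cons]
      congr 1
      abel
    · obtain ⟨B₁, B₂, S₁, S₂, h₁, h₂, rfl, rfl⟩ := hB.split ht
      refine ⟨q, hq, p, hp, _, _, _, _, hC.append h₂, .cons x hA, hone (M' := B₁) ?_⟩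
      rw [Multiset.cons_add, Multiset.add_cons, Multiset.add_cons]
      congr 1
      abel
  · refine ⟨t, ht, p, hp, _, _, _, _, hC, .cons x hA, hone (M' := B) ?_⟩
    rw [Multiset.cons_add, Multiset.add_cons, Multiset.add_cons]
    congr 1
    abel

/-- Some closed trail in `E` visits at least `k` vertices of `N`. -/
def HasClosedTrail (E : Multiset (Sym2 V)) (N : Finset V) (k : ℕ) : Prop :=
  ∃ c R S, Trail c c R S ∧ R ≤ E ∧ k ≤ (S ∩ N).card

/-- `E` contains a closed trail together with edge-disjoint trails joining four vertices of `N` to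
four vertices of it. -/
def HasWheel (E : Multiset (Sym2 V)) (N : Finset V) : Prop :=
  ∃ c R S, Trail c c R S ∧ ∃ n₁ ∈ N, ∃ n₂ ∈ N, ∃ n₃ ∈ N, ∃ n₄ ∈ N, [n₁, n₂, n₃, n₄].Nodup ∧
    ∃ w₁ ∈ S, ∃ w₂ ∈ S, ∃ w₃ ∈ S, ∃ w₄ ∈ S, [w₁, w₂, w₃, w₄].Nodup ∧
    ∃ F₁ F₂ F₃ F₄ T₁ T₂ T₃ T₄, Trail n₁ w₁ F₁ T₁ ∧ Trail n₂ w₂ F₂ T₂ ∧ Trail n₃ w₃ F₃ T₃ ∧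
      Trail n₄ w₄ F₄ T₄ ∧ R + F₁ + F₂ + F₃ + F₄ ≤ E

theorem HasClosedTrail.of_three {E R : Multiset (Sym2 V)} {N S : Finset V} {c a₁ a₂ a₃ : V}
    (h : Trail c c R S) (hR : R ≤ E) (h₁ : a₁ ∈ S) (h₂ : a₂ ∈ S) (h₃ : a₃ ∈ S)
    (k₁ : a₁ ∈ N) (k₂ : a₂ ∈ N) (k₃ : a₃ ∈ N) (d₁₂ : a₁ ≠ a₂) (d₁₃ : a₁ ≠ a₃) (d₂₃ : a₂ ≠ a₃) :
    HasClosedTrail E N 3 := by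
  refine ⟨c, R, S, h, hR, ?_⟩
  have : ({a₁, a₂, a₃} : Finset V) ⊆ S ∩ N := by
    simp [Finset.insert_subset_iff, *]
  simpa [d₁₂, d₁₃, d₂₃] using Finset.card_le_card this

/-- Three edge-disjoint trails from `p` to `q`, each visiting its own vertex of `N`, leaving room
for `M` in `E`. -/
structure Theta (E : Multiset (Sym2 V)) (N : Finset V) (M : Multiset (Sym2 V)) (p q n₁ n₂ n₃ : V)
    (R₁ R₂ R₃ : Multiset (Sym2 V)) (S₁ S₂ S₃ : Finset V) : Prop where
  t₁ : Trail p q R₁ S₁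
  t₂ : Trail p q R₂ S₂
  t₃ : Trail p q R₃ S₃
  m₁ : n₁ ∈ S₁
  m₂ : n₂ ∈ S₂
  m₃ : n₃ ∈ S₃
  k₁ : n₁ ∈ N
  k₂ : n₂ ∈ N
  k₃ : n₃ ∈ N
  d₁₂ : n₁ ≠ n₂
  d₁₃ : n₁ ≠ n₃
  d₂₃ : n₂ ≠ n₃
  le : R₁ + R₂ + R₃ + M ≤ E

namespace Theta

variable {E M R₁ R₂ R₃ F F' : Multiset (Sym2 V)} {N S₁ S₂ S₃ T T' : Finset V}
  {p q n₁ n₂ n₃ n₄ r : V}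

theorem rot (h : Theta E N M p q n₁ n₂ n₃ R₁ R₂ R₃ S₁ S₂ S₃) :
    Theta E N M p q n₂ n₃ n₁ R₂ R₃ R₁ S₂ S₃ S₁ :=
  ⟨h.t₂, h.t₃, h.t₁, h.m₂, h.m₃, h.m₁, h.k₂, h.k₃, h.k₁, h.d₂₃, h.d₁₂.symm, h.d₁₃.symm,
    le_of_eq_of_le (by abel) h.le⟩

theorem reverse (h : Theta E N M p q n₁ n₂ n₃ R₁ R₂ R₃ S₁ S₂ S₃) :
    Theta E N M q p n₁ n₂ n₃ R₁ R₂ R₃ S₁ S₂ S₃ :=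
  ⟨h.t₁.reverse, h.t₂.reverse, h.t₃.reverse, h.m₁, h.m₂, h.m₃, h.k₁, h.k₂, h.k₃, h.d₁₂, h.d₁₃,
    h.d₂₃, h.le⟩

theorem le₁₂ (h : Theta E N M p q n₁ n₂ n₃ R₁ R₂ R₃ S₁ S₂ S₃) : R₁ + R₂ ≤ E :=
  le_trans (by rw [add_assoc (R₁ + R₂)]; exact Multiset.le_add_right _ _) h.le

theorem notMem_aux (h : Theta E N M p q n₁ n₂ n₃ R₁ R₂ R₃ S₁ S₂ S₃)
    (hno : ¬ HasClosedTrail E N 3) (hr : r ∈ N) (h₁ : n₁ ≠ r) (h₂ : n₂ ≠ r) : r ∉ S₁ :=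
  fun hrS => hno (.of_three (h.t₁.append h.t₂.reverse) h.le₁₂
    (Finset.mem_union_left _ h.m₁) (Finset.mem_union_right _ h.m₂) (Finset.mem_union_left _ hrS)
    h.k₁ h.k₂ hr h.d₁₂ h₁ h₂)

theorem notMem (h : Theta E N M p q n₁ n₂ n₃ R₁ R₂ R₃ S₁ S₂ S₃)
    (hno : ¬ HasClosedTrail E N 3) : n₁ ∉ S₂ :=
  h.rot.notMem_aux hno h.k₁ h.d₁₂.symm h.d₁₃.symm

theorem ne_left (h : Theta E N M p q n₁ n₂ n₃ R₁ R₂ R₃ S₁ S₂ S₃)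
    (hno : ¬ HasClosedTrail E N 3) : n₁ ≠ p :=
  fun hp => h.notMem hno (hp ▸ h.t₂.left_mem)

theorem left_ne_right (h : Theta E N M p q n₁ n₂ n₃ R₁ R₂ R₃ S₁ S₂ S₃)
    (hno : ¬ HasClosedTrail E N 3) : p ≠ q := by
  rintro rfl
  exact hno (.of_three ((h.t₁.append h.t₂).append h.t₃)
    ((Multiset.le_add_right _ _).trans h.le) (by simp [h.m₁]) (by simp [h.m₂]) (by simp [h.m₃])
    h.k₁ h.k₂ h.k₃ h.d₁₂ h.d₁₃ h.d₂₃)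

theorem wheel_of_interior (h : Theta E N M p q n₁ n₂ n₃ R₁ R₂ R₃ S₁ S₂ S₃)
    (hno : ¬ HasClosedTrail E N 3) (k₄ : n₄ ∈ N) (d₁ : n₁ ≠ n₄) (d₂ : n₂ ≠ n₄) (d₃ : n₃ ≠ n₄)
    (hF : Trail n₄ r F T) (hFM : F ≤ M) (hr : r ∈ S₁ ∪ S₂) (hrp : r ≠ p) (h₁ : r ≠ n₁)
    (h₂ : r ≠ n₂) : HasWheel E N := by
  obtain ⟨A, B, SA, SB, hA, -, rfl, -⟩ := h.t₃.split h.m₃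
  refine ⟨p, _, _, h.t₁.append h.t₂.reverse, n₁, h.k₁, n₂, h.k₂, n₃, h.k₃, n₄, k₄, ?_,
    n₁, by simp [h.m₁], n₂, by simp [h.m₂], p, by simp [h.t₁.left_mem], r, by simpa using hr, ?_,
    0, 0, A, F, _, _, _, _, .nil _, .nil _, hA.reverse, hF, ?_⟩
  · simp [h.d₁₂, h.d₁₃, h.d₂₃, d₁, d₂, d₃]
  · simp [h.d₁₂, hrp.symm, h₁.symm, h₂.symm, h.ne_left hno, h.rot.ne_left hno]
  · refine le_trans ?_ h.le
    calc R₁ + R₂ + 0 + 0 + A + F = R₁ + R₂ + A + F := by abel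
      _ ≤ R₁ + R₂ + (A + B) + M := by
        gcongr
        exact Multiset.le_add_right _ _

theorem wheel_of_ends (h : Theta E N M p q n₁ n₂ n₃ R₁ R₂ R₃ S₁ S₂ S₃)
    (hno : ¬ HasClosedTrail E N 3) (k₄ : n₄ ∈ N) (d₁ : n₁ ≠ n₄) (d₂ : n₂ ≠ n₄) (d₃ : n₃ ≠ n₄)
    (hF : Trail n₄ q F T) (hFM : F ≤ M) : HasWheel E N :=
  h.wheel_of_interior hno k₄ d₁ d₂ d₃ hF hFM (by simp [h.t₁.right_mem])
    (h.left_ne_right hno).symm (h.reverse.ne_left hno).symm (h.reverse.rot.ne_left hno).symm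

theorem closed_of_same (h : Theta E N M p q n₁ n₂ n₃ R₁ R₂ R₃ S₁ S₂ S₃)
    (k₄ : n₄ ∈ N) (d₁ : n₁ ≠ n₄) (d₂ : n₂ ≠ n₄)
    (hF : Trail n₄ r F T) (hF' : Trail n₄ r F' T') (hM : F + F' ≤ M) (hr : r ∈ S₁) :
    HasClosedTrail E N 3 := by
  obtain ⟨A, B, SA, SB, hA, hB, rfl, rfl⟩ := h.t₁.split hr
  refine .of_three (((hA.append hF.reverse).append (hF'.append hB)).append h.t₂.reverse)
    (le_trans ?_ h.le) ?_ (by simp [h.m₂]) (by simp [hF'.left_mem]) h.k₁ h.k₂ k₄ h.d₁₂ d₁ d₂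
  · calc A + F + (F' + B) + R₂ = (A + B) + R₂ + 0 + (F + F') := by abel
      _ ≤ A + B + R₂ + R₃ + M := by
        gcongr
        exact zero_le
  · have := h.m₁
    simp only [Finset.mem_union] at this ⊢
    tauto

theorem closed_of_terminal_end (h : Theta E N M p q n₁ n₂ n₃ R₁ R₂ R₃ S₁ S₂ S₃)
    (k₄ : n₄ ∈ N) (d₁ : n₁ ≠ n₄) (d₂ : n₂ ≠ n₄)
    (hF : Trail n₄ n₁ F T) (hF' : Trail n₄ p F' T') (hM : F + F' ≤ M) :
    HasClosedTrail E N 3 := by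
  obtain ⟨A, B, SA, SB, hA, hB, rfl, rfl⟩ := h.t₁.split h.m₁
  refine .of_three ((hF'.reverse.append (hF.append hB)).append h.t₂.reverse)
    (le_trans ?_ h.le) (by simp [hB.left_mem]) (by simp [h.m₂]) (by simp [hF'.left_mem])
    h.k₁ h.k₂ k₄ h.d₁₂ d₁ d₂
  calc F' + (F + B) + R₂ = 0 + B + R₂ + 0 + (F + F') := by abel
      _ ≤ A + B + R₂ + R₃ + M := by
        gcongr <;> exact zero_le

theorem closed_of_terminals (h : Theta E N M p q n₁ n₂ n₃ R₁ R₂ R₃ S₁ S₂ S₃)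
    (k₄ : n₄ ∈ N) (d₁ : n₁ ≠ n₄) (d₂ : n₂ ≠ n₄)
    (hF : Trail n₄ n₁ F T) (hF' : Trail n₄ n₂ F' T') (hM : F + F' ≤ M) :
    HasClosedTrail E N 3 := by
  obtain ⟨A, B, SA, SB, hA, hB, rfl, rfl⟩ := h.t₁.split h.m₁
  obtain ⟨A', B', SA', SB', hA', hB', rfl, rfl⟩ := h.t₂.split h.m₂
  refine .of_three ((hA.append (hF.reverse.append hF')).append hA'.reverse)
    (le_trans ?_ h.le) (by simp [hF.right_mem]) (by simp [hF'.right_mem]) (by simp [hF'.left_mem])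
    h.k₁ h.k₂ k₄ h.d₁₂ d₁ d₂
  calc A + (F + F') + A' = A + 0 + (A' + 0) + 0 + (F + F') := by abel
      _ ≤ A + B + (A' + B') + R₃ + M := by
        gcongr <;> exact zero_le

theorem wheel_or_mem (h : Theta E N M p q n₁ n₂ n₃ R₁ R₂ R₃ S₁ S₂ S₃)
    (hno : ¬ HasClosedTrail E N 3) (k₄ : n₄ ∈ N) (d₁ : n₁ ≠ n₄) (d₂ : n₂ ≠ n₄) (d₃ : n₃ ≠ n₄)
    (hF : Trail n₄ r F T) (hFM : F ≤ M) (hr : r ∈ S₁ ∪ S₂ ∪ S₃) :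
    HasWheel E N ∨ r = p ∨ r = q ∨ r = n₁ ∨ r = n₂ ∨ r = n₃ := by
  by_contra! hcon
  obtain ⟨hw, hp, hq, h₁, h₂, h₃⟩ := hcon
  by_cases hr' : r ∈ S₁ ∪ S₂
  · exact hw (h.wheel_of_interior hno k₄ d₁ d₂ d₃ hF hFM hr' hp h₁ h₂)
  · refine hw (h.rot.wheel_of_interior hno k₄ d₂ d₃ d₁ hF hFM ?_ hp h₂ h₃)
    simp only [Finset.mem_union] at hr hr' ⊢
    tauto

theorem wheel_of_ears (h : Theta E N (F + F') p q n₁ n₂ n₃ R₁ R₂ R₃ S₁ S₂ S₃)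
    (hno : ¬ HasClosedTrail E N 3) (k₄ : n₄ ∈ N) (d₁ : n₁ ≠ n₄) (d₂ : n₂ ≠ n₄) (d₃ : n₃ ≠ n₄)
    {r' : V} (hF : Trail n₄ r F T) (hF' : Trail n₄ r' F' T') (hr : r ∈ S₁ ∪ S₂ ∪ S₃)
    (hr' : r' ∈ S₁ ∪ S₂ ∪ S₃) : HasWheel E N := by
  have hFM := Multiset.le_add_right F F'
  have hFM' := Multiset.le_add_left F' F
  have hsymm : F' + F ≤ F + F' := (add_comm F' F).le
  by_cases hrr : r = r'
  · subst hrr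
    refine absurd ?_ hno
    simp only [Finset.mem_union, or_assoc] at hr
    rcases hr with hr | hr | hr
    · exact h.closed_of_same k₄ d₁ d₂ hF hF' le_rfl hr
    · exact h.rot.closed_of_same k₄ d₂ d₃ hF hF' le_rfl hr
    · exact h.rot.rot.closed_of_same k₄ d₃ d₁ hF hF' le_rfl hr
  rcases h.wheel_or_mem hno k₄ d₁ d₂ d₃ hF hFM hr with hw | hp
  · exact hw
  rcases h.wheel_or_mem hno k₄ d₁ d₂ d₃ hF' hFM' hr' with hw | hp'
  · exact hw
  rcases hp with rfl | rfl | rfl | rfl | rfl <;> rcases hp' with rfl | rfl | rfl | rfl | rfl <;>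
  first
  | exact absurd rfl hrr
  | exact h.wheel_of_ends hno k₄ d₁ d₂ d₃ hF' hFM'
  | exact h.wheel_of_ends hno k₄ d₁ d₂ d₃ hF hFM
  | exact absurd (h.closed_of_terminal_end k₄ d₁ d₂ hF hF' le_rfl) hno
  | exact absurd (h.closed_of_terminal_end k₄ d₁ d₂ hF' hF hsymm) hno
  | exact absurd (h.rot.closed_of_terminal_end k₄ d₂ d₃ hF hF' le_rfl) hno
  | exact absurd (h.rot.closed_of_terminal_end k₄ d₂ d₃ hF' hF hsymm) hno
  | exact absurd (h.rot.rot.closed_of_terminal_end k₄ d₃ d₁ hF hF' le_rfl) hno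
  | exact absurd (h.rot.rot.closed_of_terminal_end k₄ d₃ d₁ hF' hF hsymm) hno
  | exact absurd (h.closed_of_terminals k₄ d₁ d₂ hF hF' le_rfl) hno
  | exact absurd (h.closed_of_terminals k₄ d₁ d₂ hF' hF hsymm) hno
  | exact absurd (h.rot.closed_of_terminals k₄ d₂ d₃ hF hF' le_rfl) hno
  | exact absurd (h.rot.closed_of_terminals k₄ d₂ d₃ hF' hF hsymm) hno
  | exact absurd (h.rot.rot.closed_of_terminals k₄ d₃ d₁ hF hF' le_rfl) hno
  | exact absurd (h.rot.rot.closed_of_terminals k₄ d₃ d₁ hF' hF hsymm) hno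

end Theta

/-- `E` is a loopless multiset of edges on `U`, and every nonempty proper subset of `U` is left by
at least two of them. -/
structure TwoEdgeConn (E : Multiset (Sym2 V)) (U : Finset V) : Prop where
  mem : ∀ e ∈ E, ∀ v ∈ e, v ∈ U
  loopless : ∀ e ∈ E, ¬ e.IsDiag
  cut : ∀ Z ⊆ U, Z.Nonempty → Z ≠ U → 2 ≤ (E.filter (Crosses Z)).card

namespace TwoEdgeConn

variable {E M R : Multiset (Sym2 V)} {U N S W : Finset V} {c n p q : V}

theorem exists_ears (hE : TwoEdgeConn E U) (hM : M ≤ E) (hMW : ∀ e ∈ M, ∀ v ∈ e, v ∈ W)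
    (hWU : W ⊆ U) (hW : W.Nonempty) (hn : n ∈ U) :
    ∃ p ∈ W, ∃ q ∈ W, ∃ F₁ F₂ S₁ S₂, Trail n p F₁ S₁ ∧ Trail n q F₂ S₂ ∧ M + (F₁ + F₂) ≤ E := by
  obtain ⟨p, hp, q, hq, F₁, F₂, S₁, S₂, h₁, h₂, hF⟩ := exists_two_trails (W := W) hE.mem
    hE.loopless (fun Z hZ hne hZW => hE.cut Z hZ hne fun h => by
      obtain ⟨w, hw⟩ := hW
      exact Finset.disjoint_left.mp hZW (h ▸ hWU hw) hw) hn
  obtain ⟨p', hp', F₁', S₁', h₁', hF₁, -, hS₁⟩ := h₁.firstHit hp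
  obtain ⟨q', hq', F₂', S₂', h₂', hF₂, -, hS₂⟩ := h₂.firstHit hq
  have hle := (add_le_add hF₁ hF₂).trans hF
  refine ⟨p', hp', q', hq', _, _, _, _, h₁', h₂', add_le_of_disjoint hM hle fun e heM he => ?_⟩
  have hd := hE.loopless e (Multiset.mem_of_le hM heM)
  rcases Multiset.mem_add.mp he with he | he
  · obtain ⟨v, hv, hvW⟩ := h₁'.notMem_of_firstHit hS₁ he hd
    exact hvW (hMW e heM v hv)
  · obtain ⟨v, hv, hvW⟩ := h₂'.notMem_of_firstHit hS₂ he hd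
    exact hvW (hMW e heM v hv)

end TwoEdgeConn

theorem Trail.splice {R : Multiset (Sym2 V)} {S : Finset V} {c p q : V} (h : Trail c c R S)
    (hp : p ∈ S) (hq : q ∈ S) :
    ∃ R₁ R₂ S₁ S₂, Trail p q R₁ S₁ ∧ Trail p q R₂ S₂ ∧ R₁ + R₂ = R ∧ S₁ ∪ S₂ = S := by
  obtain ⟨A, B, SA, SB, hA, hB, rfl, rfl⟩ := h.split hp
  obtain ⟨A', B', SA', SB', hA', hB', hR, hS⟩ := (hB.append hA).split (r := q) (by
    rw [Finset.union_comm]; exact hq)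
  exact ⟨A', B', SA', SB', hA', hB'.reverse, by rw [hR, add_comm],
    by rw [hS, Finset.union_comm]⟩

theorem Trail.closed_subset {R : Multiset (Sym2 V)} {S U : Finset V} {c n : V} (h : Trail c c R S)
    (hU : ∀ e ∈ R, ∀ v ∈ e, v ∈ U) (hn : n ∈ S) (hnU : n ∈ U) : S ⊆ U := by
  obtain ⟨R₁, R₂, S₁, S₂, h₁, h₂, rfl, rfl⟩ := h.splice hn hn
  exact Finset.union_subset (h₁.subset hnU fun e he => hU e (Multiset.mem_add.mpr (.inl he)))
    (h₂.subset hnU fun e he => hU e (Multiset.mem_add.mpr (.inr he)))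

theorem exists_mem_notMem_of_four_le {N : Finset V} (hN : 4 ≤ N.card) (a b c : V) :
    ∃ d ∈ N, a ≠ d ∧ b ≠ d ∧ c ≠ d := by
  have : ({a, b, c} : Finset V).card < N.card := Finset.card_le_three.trans_lt (by omega)
  obtain ⟨d, hd, hd'⟩ := Finset.exists_mem_notMem_of_card_lt_card this
  simp only [Finset.mem_insert, Finset.mem_singleton, not_or] at hd'
  exact ⟨d, hd, Ne.symm hd'.1, Ne.symm hd'.2.1, Ne.symm hd'.2.2⟩

theorem HasWheel.of_four {E R : Multiset (Sym2 V)} {N S : Finset V} {c a₁ a₂ a₃ a₄ : V}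
    (h : Trail c c R S) (hR : R ≤ E) (h₁ : a₁ ∈ S) (h₂ : a₂ ∈ S) (h₃ : a₃ ∈ S) (h₄ : a₄ ∈ S)
    (k₁ : a₁ ∈ N) (k₂ : a₂ ∈ N) (k₃ : a₃ ∈ N) (k₄ : a₄ ∈ N) (d : [a₁, a₂, a₃, a₄].Nodup) :
    HasWheel E N :=
  ⟨c, R, S, h, a₁, k₁, a₂, k₂, a₃, k₃, a₄, k₄, d, a₁, h₁, a₂, h₂, a₃, h₃, a₄, h₄, d,
    0, 0, 0, 0, _, _, _, _, .nil _, .nil _, .nil _, .nil _, by simpa using hR⟩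

namespace TwoEdgeConn

variable {E : Multiset (Sym2 V)} {U N : Finset V}

theorem wheel_of_closedTrail (hE : TwoEdgeConn E U) (hNU : N ⊆ U) (hN : 4 ≤ N.card)
    (h : HasClosedTrail E N 3) : HasWheel E N := by
  obtain ⟨c, R, S, hT, hR, hc⟩ := h
  obtain ⟨a, ha, b, hb, d, hd, hab, had, hbd⟩ := Finset.two_lt_card.mp hc
  rw [Finset.mem_inter] at ha hb hd
  obtain ⟨n, hn, han, hbn, hdn⟩ := exists_mem_notMem_of_four_le hN a b d
  by_cases hnS : n ∈ S
  · exact .of_four hT hR ha.1 hb.1 hd.1 hnS ha.2 hb.2 hd.2 hn (by simp [*])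
  have hRS : ∀ e ∈ R, ∀ v ∈ e, v ∈ S := fun e he v hv => hT.mem_of_mem_edge he hv
  obtain ⟨p, hp, q, hq, F₁, F₂, T₁, T₂, h₁, h₂, hF⟩ := hE.exists_ears hR hRS
    (hT.closed_subset (fun e he => hE.mem e (Multiset.mem_of_le hR he)) ha.1 (hNU ha.2))
    ⟨a, ha.1⟩ (hNU hn)
  have wheel : ∀ {p F T}, p ∈ S → p ∉ N → Trail n p F T → R + F ≤ E → HasWheel E N := by
    intro p F T hp hpN hpT hle
    refine ⟨c, R, S, hT, a, ha.2, b, hb.2, d, hd.2, n, hn, ?_, a, ha.1, b, hb.1, d, hd.1, p, hp,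
      ?_, 0, 0, 0, F, _, _, _, _, .nil _, .nil _, .nil _, hpT, by simpa using hle⟩
    · simp [*]
    · have : ∀ x ∈ N, x ≠ p := fun x hx hxp => hpN (hxp ▸ hx)
      simp [*]
  by_cases hpN : p ∈ N
  swap
  · exact wheel hp hpN h₁ ((add_le_add_right (Multiset.le_add_right _ _) _).trans hF)
  by_cases hqN : q ∈ N
  swap
  · exact wheel hq hqN h₂ ((add_le_add_right (Multiset.le_add_left _ _) _).trans hF)
  obtain ⟨R₁, R₂, S₁, S₂, t₁, t₂, rfl, rfl⟩ := hT.splice hp hq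
  by_cases hpq : p = q
  · subst hpq
    refine .of_four (((h₁.append t₁).append t₂).append h₂.reverse)
      (le_of_eq_of_le (by abel) hF) (a₁ := a) (a₂ := b) (a₃ := d) (a₄ := n) ?_ ?_ ?_ ?_
      ha.2 hb.2 hd.2 hn (by simp [*])
    · have := ha.1; simp only [Finset.mem_union] at this ⊢; tauto
    · have := hb.1; simp only [Finset.mem_union] at this ⊢; tauto
    · have := hd.1; simp only [Finset.mem_union] at this ⊢; tauto
    · have := h₁.left_mem; simp only [Finset.mem_union]; tauto
  have hnp : n ≠ p := fun h => hnS (h ▸ hp)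
  have hnq : n ≠ q := fun h => hnS (h ▸ hq)
  obtain ⟨t, ht, htN, hpt, hqt⟩ : ∃ t ∈ S₁ ∪ S₂, t ∈ N ∧ p ≠ t ∧ q ≠ t := by
    have : ({p, q} : Finset V).card < ((S₁ ∪ S₂) ∩ N).card := Finset.card_le_two.trans_lt hc
    obtain ⟨t, ht, ht'⟩ := Finset.exists_mem_notMem_of_card_lt_card this
    simp only [Finset.mem_insert, Finset.mem_singleton, not_or, Finset.mem_inter] at ht ht'
    exact ⟨t, ht.1, ht.2, Ne.symm ht'.1, Ne.symm ht'.2⟩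
  have hnt : n ≠ t := fun h => hnS (h ▸ ht)
  rcases Finset.mem_union.mp ht with ht | ht
  · refine .of_four ((h₁.append t₁).append h₂.reverse) (le_trans ?_ hF) (a₁ := n) (a₂ := p)
      (a₃ := q) (a₄ := t) (by simp [h₁.left_mem]) (by simp [h₁.right_mem]) (by simp [h₂.right_mem])
      (by simp [ht]) hn hpN hqN htN (by simp [*])
    calc F₁ + R₁ + F₂ = R₁ + 0 + (F₁ + F₂) := by abel
      _ ≤ _ := by gcongr; exact zero_le
  · refine .of_four ((h₁.append t₂).append h₂.reverse) (le_trans ?_ hF) (a₁ := n) (a₂ := p)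
      (a₃ := q) (a₄ := t) (by simp [h₁.left_mem]) (by simp [h₁.right_mem]) (by simp [h₂.right_mem])
      (by simp [ht]) hn hpN hqN htN (by simp [*])
    calc F₁ + R₂ + F₂ = 0 + R₂ + (F₁ + F₂) := by abel
      _ ≤ _ := by gcongr; exact zero_le

theorem exists_wheel (hE : TwoEdgeConn E U) (hNU : N ⊆ U) (hN : 4 ≤ N.card) : HasWheel E N := by
  by_cases hno : HasClosedTrail E N 3
  · exact hE.wheel_of_closedTrail hNU hN hno
  obtain ⟨n₁, k₁⟩ : N.Nonempty := Finset.card_pos.mp (by omega)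
  obtain ⟨n₂, k₂, d₁₂, -, -⟩ := exists_mem_notMem_of_four_le hN n₁ n₁ n₁
  obtain ⟨n₃, k₃, d₁₃, d₂₃, -⟩ := exists_mem_notMem_of_four_le hN n₁ n₂ n₂
  obtain ⟨n₄, k₄, d₁, d₂, d₃⟩ := exists_mem_notMem_of_four_le hN n₁ n₂ n₃
  obtain ⟨p, hp, q, hq, A, B, SA, SB, hA, hB, hAB⟩ := hE.exists_ears (M := 0) (W := {n₁})
    zero_le (by simp) (by simpa using hNU k₁) (by simp) (hNU k₂)
  rw [Finset.mem_singleton.mp hp] at hA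
  rw [Finset.mem_singleton.mp hq] at hB
  rw [zero_add] at hAB
  have hT := hA.append hB.reverse
  have hn₁ := Finset.mem_union_left SB hA.right_mem
  have hU : ∀ {R}, R ≤ E → ∀ e ∈ R, ∀ v ∈ e, v ∈ U :=
    fun hR e he => hE.mem e (Multiset.mem_of_le hR he)
  have hSU := hT.closed_subset (hU hAB) hn₁ (hNU k₁)
  obtain ⟨p, hp, q, hq, F₁, F₂, T₁, T₂, h₁, h₂, hF⟩ := hE.exists_ears hAB
    (fun e he v hv => hT.mem_of_mem_edge he hv) hSU ⟨_, hn₁⟩ (hNU k₃)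
  obtain ⟨R₁, R₂, S₁, S₂, t₁, t₂, hR, hS⟩ := hT.splice hp hq
  have hpU := hSU hp
  have t₃ := h₁.reverse.append h₂
  rw [← hR] at hF
  have same : ∀ {R S}, Trail p q R S → R ≤ R₁ + R₂ → n₁ ∈ S → n₂ ∈ S → HasWheel E N :=
    fun t hR k k' => absurd (.of_three (t.append t₃.reverse) ((add_le_add_left hR _).trans hF)
      (Finset.mem_union_left _ k) (Finset.mem_union_left _ k') (a₃ := n₃) (by simp [h₁.left_mem])
      k₁ k₂ k₃ d₁₂ d₁₃ d₂₃) hno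
  have opposite : ∀ {R R' S S'}, Trail p q R S → Trail p q R' S' → R + R' = R₁ + R₂ → n₁ ∈ S →
      n₂ ∈ S' → HasWheel E N := by
    intro R R' S S' t t' hR m m'
    rw [← hR] at hF
    have hW : S ∪ S' ∪ (T₁ ∪ T₂) ⊆ U := by
      have hE' := hU hF
      refine Finset.union_subset ((t.append t'.reverse).subset hpU fun e he => ?_)
        (t₃.subset hpU fun e he => ?_)
      · exact hE' e (Multiset.mem_add.mpr (.inl he))
      · exact hE' e (Multiset.mem_add.mpr (.inr he))
    obtain ⟨r, hr, r', hr', F, F', T, T', h, h', hle⟩ := hE.exists_ears hF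
      (W := S ∪ S' ∪ (T₁ ∪ T₂)) (fun e he v hv => by
        rcases Multiset.mem_add.mp he with he | he
        · exact Finset.mem_union_left _ ((t.append t'.reverse).mem_of_mem_edge he hv)
        · exact Finset.mem_union_right _ (t₃.mem_of_mem_edge he hv)) hW
        ⟨_, Finset.mem_union_left _ (Finset.mem_union_left _ m)⟩ (hNU k₄)
    exact (Theta.mk t t' t₃ m m' (by simp [h₁.left_mem]) k₁ k₂ k₃ d₁₂ d₁₃ d₂₃ hle).wheel_of_ears
      hno k₄ d₁ d₂ d₃ h h' hr hr'
  rw [← hS] at hn₁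
  have hn₂ : n₂ ∈ S₁ ∪ S₂ := hS ▸ Finset.mem_union_left SB hA.left_mem
  rcases Finset.mem_union.mp hn₁ with m | m <;> rcases Finset.mem_union.mp hn₂ with m' | m'
  · exact same t₁ (Multiset.le_add_right _ _) m m'
  · exact opposite t₁ t₂ rfl m m'
  · exact opposite t₂ t₁ (add_comm _ _) m m'
  · exact same t₂ (Multiset.le_add_left _ _) m m'

end TwoEdgeConn

section Wheel

variable {G : MG V} {u a b c d w₁ w₂ w₃ w₄ : V}
  {A B C D F₁ F₂ F₃ F₄ R : Multiset (Sym2 V)} {S SA SB SC SD T₁ T₂ T₃ T₄ : Finset V}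

theorem hasW4Immersion_of_trails (hu : u ∈ G.verts) (ha : a ∈ G.verts) (hb : b ∈ G.verts)
    (hc : c ∈ G.verts) (hd : d ∈ G.verts) (hnd : [u, a, b, c, d].Nodup)
    (h₁ : Trail u a F₁ T₁) (h₂ : Trail u b F₂ T₂) (h₃ : Trail u c F₃ T₃) (h₄ : Trail u d F₄ T₄)
    (hA : Trail a b A SA) (hB : Trail b c B SB) (hC : Trail c d C SC) (hD : Trail d a D SD)
    (hle : A + B + C + D + (F₁ + F₂ + F₃ + F₄) ≤ G.edges) : HasW4Immersion G := by
  obtain ⟨l₁, k₁, rfl⟩ := h₁.exists_list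
  obtain ⟨l₂, k₂, rfl⟩ := h₂.exists_list
  obtain ⟨l₃, k₃, rfl⟩ := h₃.exists_list
  obtain ⟨l₄, k₄, rfl⟩ := h₄.exists_list
  obtain ⟨lA, kA, rfl⟩ := hA.exists_list
  obtain ⟨lB, kB, rfl⟩ := hB.exists_list
  obtain ⟨lC, kC, rfl⟩ := hC.exists_list
  obtain ⟨lD, kD, rfl⟩ := hD.exists_list
  refine ⟨![u, a, b, c, d], ?_, ?_, {(s(0, 1), l₁), (s(0, 2), l₂), (s(0, 3), l₃), (s(0, 4), l₄),
    (s(1, 2), lA), (s(2, 3), lB), (s(3, 4), lC), (s(4, 1), lD)}, ?_, ?_, ?_⟩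
  · rw [← List.nodup_ofFn]
    simpa using hnd
  · simp [Fin.forall_fin_succ, *]
  · simp [w4Edges]
  · simp only [Multiset.insert_eq_cons, Multiset.mem_cons, Multiset.mem_singleton, forall_eq_or_imp,
      forall_eq]
    exact ⟨⟨_, _, rfl, k₁⟩, ⟨_, _, rfl, k₂⟩, ⟨_, _, rfl, k₃⟩, ⟨_, _, rfl, k₄⟩, ⟨_, _, rfl, kA⟩,
      ⟨_, _, rfl, kB⟩, ⟨_, _, rfl, kC⟩, ⟨_, _, rfl, kD⟩⟩
  · refine le_of_eq_of_le ?_ hle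
    simp only [Multiset.insert_eq_cons, Multiset.map_cons, Multiset.map_singleton,
      Multiset.sum_cons, Multiset.sum_singleton]
    abel

theorem hasW4Immersion_of_three (hu : u ∈ G.verts) (ha : a ∈ G.verts) (hb : b ∈ G.verts)
    (hc : c ∈ G.verts) (hd : d ∈ G.verts) (hnd : [u, a, b, c, d].Nodup)
    (h₁ : Trail u a F₁ T₁) (h₂ : Trail u b F₂ T₂) (h₃ : Trail u c F₃ T₃) (h₄ : Trail u d F₄ T₄)
    (hA : Trail a b A SA) (hB : Trail b c B SB) (hC : Trail c a C SC) (hm : d ∈ SA ∪ SB ∪ SC)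
    (hle : A + B + C + (F₁ + F₂ + F₃ + F₄) ≤ G.edges) : HasW4Immersion G := by
  simp only [Finset.mem_union, or_assoc] at hm
  rcases hm with hm | hm | hm
  · obtain ⟨A, A', SA, SA', t, t', rfl, -⟩ := hA.split hm
    refine hasW4Immersion_of_trails hu ha hd hb hc ?_ h₁ h₄ h₂ h₃ t t' hB hC
      (le_of_eq_of_le (by abel) hle)
    simp at hnd ⊢; tauto
  · obtain ⟨B, B', SB, SB', t, t', rfl, -⟩ := hB.split hm
    refine hasW4Immersion_of_trails hu ha hb hd hc ?_ h₁ h₂ h₄ h₃ hA t t' hC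
      (le_of_eq_of_le (by abel) hle)
    simp at hnd ⊢; tauto
  · obtain ⟨C, C', SC, SC', t, t', rfl, -⟩ := hC.split hm
    refine hasW4Immersion_of_trails hu ha hb hc hd ?_ h₁ h₂ h₃ h₄ hA hB t t'
      (le_of_eq_of_le (by abel) hle)
    simp at hnd ⊢; tauto

theorem hasW4Immersion_of_closed (hu : u ∈ G.verts) (ha : a ∈ G.verts) (hb : b ∈ G.verts)
    (hc : c ∈ G.verts) (hd : d ∈ G.verts) (hnd : [u, a, b, c, d].Nodup)
    (h₁ : Trail u a F₁ T₁) (h₂ : Trail u b F₂ T₂) (h₃ : Trail u c F₃ T₃) (h₄ : Trail u d F₄ T₄)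
    {x : V} (hR : Trail x x R S) (ma : a ∈ S) (mb : b ∈ S) (mc : c ∈ S) (md : d ∈ S)
    (hle : R + (F₁ + F₂ + F₃ + F₄) ≤ G.edges) : HasW4Immersion G := by
  obtain ⟨A, B, SA, SB, hA, hB, rfl, rfl⟩ := hR.splice ma mb
  rcases Finset.mem_union.mp mc with mc | mc
  · obtain ⟨A, A', SA, SA', t, t', rfl, rfl⟩ := hA.split mc
    refine hasW4Immersion_of_three hu ha hc hb hd ?_ h₁ h₃ h₂ h₄ t t' hB.reverse md
      (le_of_eq_of_le (by abel) hle)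
    simp at hnd ⊢; tauto
  · obtain ⟨B, B', SB, SB', t, t', rfl, rfl⟩ := hB.split mc
    refine hasW4Immersion_of_three hu ha hc hb hd ?_ h₁ h₃ h₂ h₄ t t' hA.reverse ?_
      (le_of_eq_of_le (by abel) hle)
    · simp at hnd ⊢; tauto
    · rwa [Finset.union_comm]

/-- A wheel in `E` whose edges can be realised by edge-disjoint trails in `G` yields a `W₄`. -/
theorem HasWheel.hasW4Immersion {E : Multiset (Sym2 V)} {U N : Finset V} (h : HasWheel E N)
    (hE : ∀ e ∈ E, ∀ v ∈ e, v ∈ U) (hN : N ⊆ U) (hU : U ⊆ G.verts) (hu : u ∈ G.verts)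
    (huU : u ∉ U) {P : Sym2 V → Multiset (Sym2 V)} {f : V → Multiset (Sym2 V)}
    (hP : ∀ x y, s(x, y) ∈ E → ∃ T, Trail x y (P s(x, y)) T)
    (hf : ∀ n ∈ N, ∃ T, Trail u n (f n) T)
    (hle : (E.map P).sum + ∑ n ∈ N, f n ≤ G.edges) : HasW4Immersion G := by
  obtain ⟨c, R, S, hR, n₁, k₁, n₂, k₂, n₃, k₃, n₄, k₄, hn, w₁, m₁, w₂, m₂, w₃, m₃, w₄, m₄, hw,
    F₁, F₂, F₃, F₄, T₁, T₂, T₃, T₄, h₁, h₂, h₃, h₄, hE'⟩ := h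
  obtain ⟨Q, rfl⟩ := exists_add_of_le hE'
  have key : ∀ {F n w T}, n ∈ N → Trail n w F T → F ≤ R + F₁ + F₂ + F₃ + F₄ + Q →
      w ∈ U ∧ ∃ T, Trail u w (f n + (F.map P).sum) T := by
    intro F n w T hn h hF
    refine ⟨h.subset (hN hn) (fun e he => hE e (Multiset.mem_of_le hF he)) h.right_mem, ?_⟩
    obtain ⟨T', hT'⟩ := hf n hn
    obtain ⟨T'', hT'', -⟩ := h.lift fun x y hxy => hP x y (Multiset.mem_of_le hF hxy)
    exact ⟨_, hT'.append hT''⟩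
  obtain ⟨u₁, _, t₁⟩ := key k₁ h₁ (le_iff_exists_add.mpr ⟨R + F₂ + F₃ + F₄ + Q, by abel⟩)
  obtain ⟨u₂, _, t₂⟩ := key k₂ h₂ (le_iff_exists_add.mpr ⟨R + F₁ + F₃ + F₄ + Q, by abel⟩)
  obtain ⟨u₃, _, t₃⟩ := key k₃ h₃ (le_iff_exists_add.mpr ⟨R + F₁ + F₂ + F₄ + Q, by abel⟩)
  obtain ⟨u₄, _, t₄⟩ := key k₄ h₄ (le_iff_exists_add.mpr ⟨R + F₁ + F₂ + F₃ + Q, by abel⟩)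
  obtain ⟨S', hR', hSS'⟩ := hR.lift fun x y hxy => hP x y (by simp [hxy])
  have hne : ∀ w ∈ U, u ≠ w := fun w hw h => huU (h ▸ hw)
  refine hasW4Immersion_of_closed hu (hU u₁) (hU u₂) (hU u₃) (hU u₄) ?_ t₁ t₂ t₃ t₄ hR'
    (hSS' m₁) (hSS' m₂) (hSS' m₃) (hSS' m₄) (le_trans ?_ hle)
  · rw [List.nodup_cons]
    exact ⟨by simp [hne _ u₁, hne _ u₂, hne _ u₃, hne _ u₄], hw⟩
  · have hsum : f n₁ + f n₂ + f n₃ + f n₄ ≤ ∑ n ∈ N, f n := by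
      refine le_trans (le_of_eq ?_) (Finset.sum_le_sum_of_subset (s := {n₁, n₂, n₃, n₄}) ?_)
      · simp at hn
        rw [Finset.sum_insert, Finset.sum_insert, Finset.sum_insert, Finset.sum_singleton]
        · abel
        all_goals simp; tauto
      · simp [Finset.insert_subset_iff, *]
    simp only [Multiset.map_add, Multiset.sum_add]
    calc _ = (R.map P).sum + (F₁.map P).sum + (F₂.map P).sum + (F₃.map P).sum + (F₄.map P).sum + 0 +
          (f n₁ + f n₂ + f n₃ + f n₄) := by abel
      _ ≤ _ := by gcongr; exact zero_le

end Wheel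

theorem isBridge_of_isAcyclic {α β : Type} {G : SimpleGraph α}
    {K : SimpleGraph β} (hG : G.IsAcyclic) (f : G ↪g K)
    (hf : ∀ a x, K.Adj (f a) x → x ∈ Set.range f) {a b : α} (hab : G.Adj a b) :
    K.IsBridge s(f a, f b) := by
  have key : ∀ {x y}, (K.deleteEdges {s(f a, f b)}).Walk x y → ∀ c d, f c = x → f d = y →
      (G.deleteEdges {s(a, b)}).Reachable c d := by
    intro x y p
    induction p with
    | nil =>
      rintro c d rfl h
      rw [f.injective h]
    | cons hadj p ih =>
      rintro c d rfl rfl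
      rw [SimpleGraph.deleteEdges_adj] at hadj
      obtain ⟨m, rfl⟩ := hf _ _ hadj.1
      refine .trans (SimpleGraph.Adj.reachable ?_) (ih m d rfl rfl)
      rw [SimpleGraph.deleteEdges_adj]
      refine ⟨f.map_adj_iff.mp hadj.1, fun h => hadj.2 ?_⟩
      have := congrArg (Sym2.map f) (Set.mem_singleton_iff.mp h)
      simpa using this
  rintro ⟨p⟩
  exact SimpleGraph.isAcyclic_iff_forall_adj_isBridge.mp hG hab (key p a b rfl rfl)

theorem isTree_sum_sup_edge {α β : Type} {G : SimpleGraph α} {K : SimpleGraph β}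
    (hG : G.IsTree) (hK : K.IsTree) (i : α) (j : β) :
    ((G ⊕g K) ⊔ SimpleGraph.edge (.inl i) (.inr j)).IsTree := by
  have hac : (G ⊕g K).IsAcyclic := by
    rw [SimpleGraph.isAcyclic_iff_forall_adj_isBridge]
    rintro (v | v) (w | w) hvw
    · exact isBridge_of_isAcyclic hG.isAcyclic SimpleGraph.Embedding.sumInl
        (by rintro a (x | x) h <;> simp_all) (SimpleGraph.sum_adj_inl.mp hvw)
    · simp at hvw
    · simp at hvw
    · exact isBridge_of_isAcyclic hK.isAcyclic SimpleGraph.Embedding.sumInr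
        (by rintro a (x | x) h <;> simp_all) (SimpleGraph.sum_adj_inr.mp hvw)
  exact ⟨hG.connected.sum_sup_edge hK.connected,
    hac.sup_edge_of_not_reachable (SimpleGraph.not_reachable_sum_inl_inr _ _)⟩

/-- `X` has a tree-decomposition of width at most three, some bag of which contains both ends of
`e` for each `e ∈ H`. -/
def HasDecomp (X : Finset V) (H : Set (Sym2 V)) : Prop :=
  ∃ (ι : Type) (T : SimpleGraph ι) (B : ι → Finset V), T.IsTree ∧ (∀ t, B t ⊆ X) ∧
    (∀ v ∈ X, ∃ t, v ∈ B t) ∧ (∀ e ∈ H, ∃ t, ∀ v ∈ e, v ∈ B t) ∧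
    (∀ v ∈ X, (SimpleGraph.induce {t | v ∈ B t} T).Connected) ∧ ∀ t, (B t).card ≤ 4

namespace HasDecomp

variable {X A B : Finset V} {H HA HB : Set (Sym2 V)}

theorem of_card_le (hX : X.card ≤ 4) (hH : ∀ e ∈ H, ∀ v ∈ e, v ∈ X) : HasDecomp X H := by
  refine ⟨Unit, ⊥, fun _ => X, .of_subsingleton, fun _ => subset_rfl, fun v hv => ⟨(), hv⟩,
    fun e he => ⟨(), hH e he⟩, fun v hv => ?_, fun _ => hX⟩
  have : Nonempty {t : Unit | v ∈ X} := ⟨⟨(), hv⟩⟩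
  exact .of_subsingleton

theorem insert_diag (h : HasDecomp X H) {s : V} (hs : s ∈ X) :
    HasDecomp X (insert s(s, s) H) := by
  obtain ⟨ι, T, B, hT, hB, hv, he, hc⟩ := h
  refine ⟨ι, T, B, hT, hB, hv, ?_, hc⟩
  rintro e (rfl | h)
  · simpa using hv s hs
  · exact he e h

theorem glue (hA : HasDecomp A HA) (hB : HasDecomp B HB) (hX : X = A ∪ B)
    (hH : ∀ e ∈ H, e ∈ HA ∨ e ∈ HB) (hSA : ∃ e ∈ HA, ∀ v ∈ A ∩ B, v ∈ e)
    (hSB : ∃ e ∈ HB, ∀ v ∈ A ∩ B, v ∈ e) : HasDecomp X H := by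
  subst hX
  obtain ⟨ι, T, C, hT, hC, hv, he, hc, hk⟩ := hA
  obtain ⟨κ, T', C', hT', hC', hv', he', hc', hk'⟩ := hB
  obtain ⟨e, heA, hS⟩ := hSA
  obtain ⟨e', heB, hS'⟩ := hSB
  obtain ⟨i, hi⟩ := he e heA
  obtain ⟨j, hj⟩ := he' e' heB
  set K := (T ⊕g T') ⊔ SimpleGraph.edge (.inl i) (.inr j) with hK
  have left : ∀ v ∈ A, (K.induce (Sum.inl '' {t | v ∈ C t})).Connected := by
    intro v hv
    refine (hc v hv).map (H := K.induce (Sum.inl '' {t | v ∈ C t}))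
      ⟨fun t => ⟨.inl t.1, t.1, t.2, rfl⟩, ?_⟩ ?_
    · intro a b hab
      simp_all
    · rintro ⟨-, t, ht, rfl⟩
      exact ⟨⟨t, ht⟩, rfl⟩
  have right : ∀ v ∈ B, (K.induce (Sum.inr '' {t | v ∈ C' t})).Connected := by
    intro v hv
    refine (hc' v hv).map (H := K.induce (Sum.inr '' {t | v ∈ C' t}))
      ⟨fun t => ⟨.inr t.1, t.1, t.2, rfl⟩, ?_⟩ ?_
    · intro a b hab
      simp_all
    · rintro ⟨-, t, ht, rfl⟩
      exact ⟨⟨t, ht⟩, rfl⟩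
  have hset : ∀ v, {t | v ∈ Sum.elim C C' t} =
      Sum.inl '' {t | v ∈ C t} ∪ Sum.inr '' {t | v ∈ C' t} := by
    intro v
    ext (t | t) <;> simp
  refine ⟨ι ⊕ κ, K, Sum.elim C C', isTree_sum_sup_edge hT hT' i j, ?_, ?_, ?_, ?_, ?_⟩
  · rintro (t | t)
    · exact (hC t).trans Finset.subset_union_left
    · exact (hC' t).trans Finset.subset_union_right
  · intro v hvX
    rcases Finset.mem_union.mp hvX with h | h
    · obtain ⟨t, ht⟩ := hv v h
      exact ⟨.inl t, ht⟩
    · obtain ⟨t, ht⟩ := hv' v h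
      exact ⟨.inr t, ht⟩
  · intro e heH
    rcases hH e heH with h | h
    · obtain ⟨t, ht⟩ := he e h
      exact ⟨.inl t, ht⟩
    · obtain ⟨t, ht⟩ := he' e h
      exact ⟨.inr t, ht⟩
  · intro v hvX
    rw [hset]
    by_cases hvA : v ∈ A <;> by_cases hvB : v ∈ B
    · have hvS := Finset.mem_inter.mpr ⟨hvA, hvB⟩
      refine SimpleGraph.connected_induce_union (left v hvA).preconnected
        (right v hvB).preconnected (v := .inl i) (w := .inr j) ⟨i, hi v (hS v hvS), rfl⟩
        ⟨j, hj v (hS' v hvS), rfl⟩ ?_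
      simp [hK, SimpleGraph.edge_adj]
    · have : {t | v ∈ C' t} = ∅ := Set.eq_empty_of_forall_notMem fun t ht => hvB (hC' t ht)
      rw [this, Set.image_empty, Set.union_empty]
      exact left v hvA
    · have : {t | v ∈ C t} = ∅ := Set.eq_empty_of_forall_notMem fun t ht => hvA (hC t ht)
      rw [this, Set.image_empty, Set.empty_union]
      exact right v hvB
    · exact absurd hvX (by simp [hvA, hvB])
  · rintro (t | t)
    · exact hk t
    · exact hk' t

theorem treewidth_le {G : MG V} (h : HasDecomp G.verts {e | e ∈ G.edges}) : treewidth G ≤ 3 := by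
  obtain ⟨ι, T, B, h⟩ := h
  exact Nat.sInf_le ⟨ι, T, B, h⟩

end HasDecomp

/-- The edges of `G` lying in the part of `G` that the projection `π` sends to `e`. -/
def piece (G : MG V) (π : V → Sym2 V) (e : Sym2 V) : Multiset (Sym2 V) :=
  G.edges.filter fun g => ∀ v ∈ g, v ∈ e ∨ π v = e

/-- `H` is a graph on `X` whose edges stand for edge-disjoint trails in `G`. The map `π` sends
each vertex of `G` outside `X` to the edge of `H`, or the vertex of `X`, to which the part of `G`
around it is attached. -/
structure Torso (G : MG V) (X : Finset V) (H : Finset (Sym2 V)) (π : V → Sym2 V) : Prop where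
  sub : X ⊆ G.verts
  mem : ∀ e ∈ H, ∀ v ∈ e, v ∈ X
  loopless : ∀ e ∈ H, ¬ e.IsDiag
  proj_self : ∀ v ∈ X, π v = s(v, v)
  proj : ∀ v ∈ G.verts, v ∉ X → π v ∈ H ∨ ∃ a ∈ X, π v = s(a, a)
  adj_mem : ∀ v w, s(v, w) ∈ G.edges → v ∈ X → w ∈ X → s(v, w) ∈ H
  adj_eq : ∀ v w, s(v, w) ∈ G.edges → v ∉ X → w ∉ X → π v = π w
  adj_attach : ∀ v w, s(v, w) ∈ G.edges → v ∉ X → w ∈ X → w ∈ π v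
  trail : ∀ a b, s(a, b) ∈ H → ∃ E S, Trail a b E S ∧ E ≤ piece G π s(a, b)

theorem sum_le_of_disjoint {α β : Type} {s : Finset α} {f : α → Multiset β} {M : Multiset β}
    (hf : ∀ a ∈ s, f a ≤ M) (hd : ∀ a ∈ s, ∀ b ∈ s, ∀ x ∈ f a, x ∈ f b → a = b) :
    ∑ a ∈ s, f a ≤ M := by
  induction s using Finset.induction_on with
  | empty => simp
  | insert a s ha ih =>
    rw [Finset.sum_insert ha]
    refine add_le_of_disjoint (hf a (by simp)) (ih (fun b hb => hf b (by simp [hb]))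
      fun b hb c hc => hd b (by simp [hb]) c (by simp [hc])) fun x hx hx' => ?_
    obtain ⟨b, hb, hxb⟩ := Multiset.mem_sum.mp hx'
    exact ha (hd a (by simp) b (by simp [hb]) x hx hxb ▸ hb)

/-- `A` and `B` cover `X`, neither contains the other, and no edge of `H` leaves both. -/
structure Separation (X : Finset V) (H : Finset (Sym2 V)) (A B : Finset V) : Prop where
  union : A ∪ B = X
  left : (A \ B).Nonempty
  right : (B \ A).Nonempty
  edge : ∀ x y, s(x, y) ∈ H → x ∈ A → x ∉ B → y ∈ B → y ∈ A

namespace Separation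

variable {X A B : Finset V} {H : Finset (Sym2 V)}

theorem symm (h : Separation X H A B) : Separation X H B A where
  union := by rw [Finset.union_comm, h.union]
  left := h.right
  right := h.left
  edge x y hxy hx hxA hy := by
    by_contra hyB
    exact hxA (h.edge y x (by rwa [Sym2.eq_swap]) hy hyB hx)

theorem card_lt (h : Separation X H A B) : A.card < X.card := by
  rw [← h.union]
  refine Finset.card_lt_card (Finset.ssubset_iff_subset_ne.mpr ⟨Finset.subset_union_left, ?_⟩)
  intro hAB
  obtain ⟨b, hb⟩ := h.right
  rw [Finset.mem_sdiff] at hb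
  exact hb.2 (hAB ▸ Finset.mem_union_right _ hb.1)

end Separation

/-- The edges of `H` inside `A`, together with an edge `st` when `s ≠ t`. -/
def sideEdges (H : Finset (Sym2 V)) (A : Finset V) (s t : V) : Finset (Sym2 V) :=
  H.filter (fun e => ∀ v ∈ e, v ∈ A) ∪ if s = t then ∅ else {s(s, t)}

namespace Torso

variable {G : MG V} {X A B : Finset V} {H : Finset (Sym2 V)} {π : V → Sym2 V}

theorem piece_disjoint (h : Torso G X H π) {e e' g : Sym2 V} (he : e ∈ H) (he' : e' ∈ H)
    (hg : g ∈ piece G π e) (hg' : g ∈ piece G π e') : e = e' := by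
  by_contra hne
  have key : ∀ {e e' : Sym2 V}, e ∈ H → e' ∈ H → ∀ v ∈ e', π v ≠ e := by
    rintro e e' he he' v hv rfl
    exact h.loopless _ he (by simp [h.proj_self v (h.mem e' he' v hv)])
  obtain ⟨hgG, hge⟩ := Multiset.mem_filter.mp hg
  obtain ⟨-, hge'⟩ := Multiset.mem_filter.mp hg'
  have hmem : ∀ v ∈ g, v ∈ e ∧ v ∈ e' := by
    intro v hv
    rcases hge v hv with h₁ | h₁ <;> rcases hge' v hv with h₂ | h₂
    · exact ⟨h₁, h₂⟩
    · exact absurd h₂ (key he' he v h₁)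
    · exact absurd h₁ (key he he' v h₂)
    · exact absurd (h₁.symm.trans h₂) hne
  induction g with | _ x y
  have hxy : x ≠ y := by simpa using G.loopless _ hgG
  have hx := hmem x (by simp)
  have hy := hmem y (by simp)
  exact hne (((Sym2.mem_and_mem_iff hxy).mp ⟨hx.1, hy.1⟩).trans
    ((Sym2.mem_and_mem_iff hxy).mp ⟨hx.2, hy.2⟩).symm)

theorem sum_le (h : Torso G X H π) {Q : Finset (Sym2 V)} (hQ : Q ⊆ H)
    {P : Sym2 V → Multiset (Sym2 V)} (hP : ∀ e ∈ Q, P e ≤ piece G π e) :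
    ∑ e ∈ Q, P e ≤ G.edges :=
  sum_le_of_disjoint (fun e he => (hP e he).trans (Multiset.filter_le _ _))
    fun _ ha _ hb _ hx hx' => h.piece_disjoint (hQ ha) (hQ hb) (Multiset.mem_of_le (hP _ ha) hx)
      (Multiset.mem_of_le (hP _ hb) hx')

/-- A choice of the edge sets of the trails realising the edges of `H`. -/
theorem exists_realisation (h : Torso G X H π) : ∃ P : Sym2 V → Multiset (Sym2 V),
    (∀ a b, s(a, b) ∈ H → ∃ S, Trail a b (P s(a, b)) S) ∧ ∀ e ∈ H, P e ≤ piece G π e := by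
  have : ∀ e : Sym2 V, ∃ E, e ∈ H →
      (∀ a b, e = s(a, b) → ∃ S, Trail a b E S) ∧ E ≤ piece G π e := by
    intro e
    by_cases he : e ∈ H
    · induction e with | _ a b
      obtain ⟨E, S, ht, hE⟩ := h.trail a b he
      refine ⟨E, fun _ => ⟨fun x y hxy => ?_, hE⟩⟩
      rcases Sym2.eq_iff.mp hxy with ⟨rfl, rfl⟩ | ⟨rfl, rfl⟩
      · exact ⟨S, ht⟩
      · exact ⟨S, ht.reverse⟩
    · exact ⟨0, fun h => absurd h he⟩
  choose P hP using this
  exact ⟨P, fun a b hab => (hP _ hab).1 a b rfl, fun e he => (hP e he).2⟩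

theorem restrict (h : Torso G X H π) (hsep : Separation X H A B) {s t : V} (hs : s ∈ A)
    (ht : t ∈ A) (hst : ∀ v ∈ A, v ∈ B → v = s ∨ v = t)
    (htr : s ≠ t → ∃ E S, Trail s t E S ∧ E ≤ (H.filter fun e => ∀ v ∈ e, v ∈ B).val) :
    Torso G A (sideEdges H A s t) fun v => if ∀ x ∈ π v, x ∈ A then π v else s(s, t) := by
  have hAX : A ⊆ X := hsep.union ▸ Finset.subset_union_left
  have hXB : ∀ v ∈ X, v ∉ A → v ∈ B := fun v hv hvA => by
    rw [← hsep.union, Finset.mem_union] at hv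
    tauto
  have hout : ∀ v ∈ X, v ∉ A → ¬ ∀ x ∈ π v, x ∈ A := fun v hv hvA hall =>
    hvA (hall v (by simp [h.proj_self v hv]))
  have hmemS : ∀ v w, s(v, w) ∈ H → v ∉ A → w ∈ A → w = s ∨ w = t := by
    intro v w hvw hv hw
    have hvX := h.mem _ hvw v (by simp)
    refine hst w hw ?_
    by_contra hwB
    exact hv (hsep.edge w v (by rwa [Sym2.eq_swap]) hw hwB (hXB v hvX hv))
  refine ⟨hAX.trans h.sub, ?_, ?_, ?_, ?_, ?_, ?_, ?_, ?_⟩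
  · intro e he
    simp only [sideEdges, Finset.mem_union, Finset.mem_filter] at he
    split_ifs at he with hst'
    · simpa using fun v => (he.resolve_right (by simp)).2 v
    · rcases he with he | he
      · exact he.2
      · rw [Finset.mem_singleton.mp he]
        simp [hs, ht]
  · intro e he
    simp only [sideEdges, Finset.mem_union, Finset.mem_filter] at he
    split_ifs at he with hst'
    · exact h.loopless e (he.resolve_right (by simp)).1
    · rcases he with he | he
      · exact h.loopless e he.1
      · simpa [Finset.mem_singleton.mp he] using hst'
  · intro v hv
    simp [h.proj_self v (hAX hv), hv]
  · intro v hv hvA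
    split_ifs with hall
    · have hvX : v ∉ X := fun hvX => hout v hvX hvA hall
      rcases h.proj v hv hvX with hH | ⟨a, ha, hπ⟩
      · left
        simpa [sideEdges, hH] using Or.inl hall
      · exact .inr ⟨a, hall a (by simp [hπ]), hπ⟩
    · by_cases hst' : s = t
      · exact .inr ⟨s, hs, by rw [hst']⟩
      · left
        simp [sideEdges, hst']
  · intro v w hvw hv hw
    simp [sideEdges, h.adj_mem v w hvw (hAX hv) (hAX hw), hv, hw]
  · intro v w hvw hv hw
    by_cases hvX : v ∈ X <;> by_cases hwX : w ∈ X
    · rw [if_neg (hout v hvX hv), if_neg (hout w hwX hw)]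
    · rw [if_neg (hout v hvX hv), if_neg fun hall => hv (hall v
        (h.adj_attach w v (by rwa [Sym2.eq_swap]) hwX hvX))]
    · rw [if_neg (hout w hwX hw), if_neg fun hall => hw (hall w (h.adj_attach v w hvw hvX hwX))]
    · rw [h.adj_eq v w hvw hvX hwX]
  · intro v w hvw hv hw
    by_cases hvX : v ∈ X
    · rw [if_neg (hout v hvX hv)]
      simpa using hmemS v w (h.adj_mem v w hvw hvX (hAX hw)) hv hw
    · have hwπ := h.adj_attach v w hvw hvX (hAX hw)
      split_ifs with hall
      · exact hwπ
      · rcases h.proj v (G.edge_support _ hvw v (by simp)) hvX with hH | ⟨a, ha, hπ⟩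
        · obtain ⟨x, hx⟩ := hwπ
          rw [hx] at hH hall
          have hxA : x ∉ A := fun hxA => hall (by simp [hw, hxA])
          simpa using hmemS x w (by rwa [Sym2.eq_swap]) hxA hw
        · rw [hπ] at hall hwπ
          simp at hall hwπ
          exact absurd (hwπ ▸ hw) hall
  · intro a b hab
    by_cases hH : s(a, b) ∈ H ∧ a ∈ A ∧ b ∈ A
    · obtain ⟨E, S, hT, hE⟩ := h.trail a b hH.1
      refine ⟨E, S, hT, hE.trans (Multiset.monotone_filter_right _ fun g hg v hv => ?_)⟩
      refine (hg v hv).imp_right fun hπ => ?_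
      dsimp only
      rw [if_pos, hπ]
      rw [hπ]
      simpa using hH.2
    obtain ⟨hst', hab⟩ : s ≠ t ∧ s(a, b) = s(s, t) := by
      simp only [sideEdges, Finset.mem_union, Finset.mem_filter] at hab
      split_ifs at hab with hst'
      · simp at hab
        tauto
      · refine ⟨hst', ?_⟩
        simp at hab ⊢
        tauto
    obtain ⟨E, S, hT, hE⟩ := htr hst'
    obtain ⟨P, hP, hPle⟩ := h.exists_realisation
    have hEH : ∀ e ∈ E, e ∈ H ∧ ∀ v ∈ e, v ∈ B := fun e he =>
      Finset.mem_filter.mp (Finset.mem_val.mp (Multiset.mem_of_le hE he))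
    obtain ⟨T, hT', -⟩ := hT.lift fun x y hxy => hP x y (hEH _ hxy).1
    rw [hab]
    have hle : (E.map P).sum ≤ piece G (fun v => if ∀ x ∈ π v, x ∈ A then π v else s(s, t))
        s(s, t) := by
      refine Multiset.le_filter.mpr ⟨?_, ?_⟩
      · refine le_trans ?_ (h.sum_le (Q := H.filter fun e => ∀ v ∈ e, v ∈ B)
          (Finset.filter_subset _ _) fun e he => hPle e (Finset.mem_filter.mp he).1)
        obtain ⟨E', hE'⟩ := exists_add_of_le hE
        rw [Finset.sum, hE', Multiset.map_add, Multiset.sum_add]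
        exact Multiset.le_add_right _ _
      · intro g hg v hv
        obtain ⟨f, hf, hgf⟩ := Multiset.mem_bind.mp hg
        obtain ⟨hfH, hfB⟩ := hEH f hf
        rcases (Multiset.mem_filter.mp (Multiset.mem_of_le (hPle f hfH) hgf)).2 v hv with hvf | hπ
        · have hvB := hfB v hvf
          by_cases hvA : v ∈ A
          · exact .inl (by simpa using hst v hvA hvB)
          · exact .inr (if_neg (hout v (h.mem f hfH v hvf) hvA))
        · right
          dsimp only
          split_ifs with hall
          · rw [hπ] at hall ⊢
            induction f with | _ x y
            have hxy : x ≠ y := by simpa using h.loopless _ hfH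
            have hx := hst x (hall x (by simp)) (hfB x (by simp))
            have hy := hst y (hall y (by simp)) (hfB y (by simp))
            refine ((Sym2.mem_and_mem_iff hxy).mp ⟨?_, ?_⟩).symm <;> simpa
          · rfl
    rcases Sym2.eq_iff.mp hab with ⟨rfl, rfl⟩ | ⟨rfl, rfl⟩
    · exact ⟨_, _, hT', hle⟩
    · exact ⟨_, _, hT'.reverse, hle⟩

end Torso

namespace Separation

variable {X A B : Finset V} {H : Finset (Sym2 V)} {s t : V}

theorem exists_trail (h : Separation X H A B)
    (hAB : A ∩ B = {s, t}) (hst : s ≠ t)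
    (hmin : ∀ A B, Separation X H A B → 2 ≤ (A ∩ B).card) :
    ∃ E S, Trail s t E S ∧ E ≤ (H.filter fun e => ∀ v ∈ e, v ∈ B).val := by
  have hmem : ∀ v, v ∈ A ∧ v ∈ B ↔ v = s ∨ v = t := fun v => by
    rw [← Finset.mem_inter, hAB]
    simp
  obtain ⟨hsA, hsB⟩ := (hmem s).mpr (.inl rfl)
  obtain ⟨htA, htB⟩ := (hmem t).mpr (.inr rfl)
  have hX : ∀ v, v ∈ X ↔ v ∈ A ∨ v ∈ B := fun v => by rw [← h.union, Finset.mem_union]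
  suffices hcut : ∀ Z ⊆ B, s ∈ Z → Disjoint Z {t} →
      ∃ e ∈ (H.filter fun e => ∀ v ∈ e, v ∈ B).val, Crosses Z e by
    obtain ⟨w, hw, E, S, hT, hE⟩ := PaperW4.exists_trail
      (fun e he => (Finset.mem_filter.mp (Finset.mem_val.mp he)).2) hsB hcut
    obtain rfl := Finset.mem_singleton.mp hw
    exact ⟨E, S, hT, hE⟩
  intro Z hZ hsZ htZ
  rw [Finset.disjoint_singleton_right] at htZ
  by_contra! hno
  have hcross : ∀ x y, s(x, y) ∈ H → x ∈ Z → y ∈ B → y ∈ Z := by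
    intro x y hxy hx hy
    by_contra hyZ
    refine hno s(x, y) (Finset.mem_val.mpr (Finset.mem_filter.mpr ⟨hxy, ?_⟩)) ⟨x, y, rfl, hx, hyZ⟩
    simp [hZ hx, hy]
  have hedge := h.edge
  have hone : ∀ A' B', Separation X H A' B' → ∀ v, A' ∩ B' ⊆ {v} → False := by
    intro A' B' h' v hv
    have hle := Finset.card_le_card hv
    have hge := hmin A' B' h'
    rw [Finset.card_singleton] at hle
    omega
  by_cases hZs : Z ⊆ {s}
  · refine hone A (B \ {s}) ⟨?_, ?_, ?_, ?_⟩ t ?_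
    · ext v
      have := hmem v
      simp only [Finset.mem_union, Finset.mem_sdiff, Finset.mem_singleton, hX]
      grind
    · exact ⟨s, by simp [hsA]⟩
    · obtain ⟨b, hb⟩ := h.right
      simp only [Finset.mem_sdiff] at hb
      refine ⟨b, ?_⟩
      simp only [Finset.mem_sdiff, Finset.mem_singleton]
      grind
    · intro x y hxy hx hxB hy
      simp only [Finset.mem_sdiff, Finset.mem_singleton] at hxB hy
      grind
    · intro v
      simp only [Finset.mem_inter, Finset.mem_sdiff, Finset.mem_singleton]
      grind
  · refine hone Z ((X \ Z) ∪ {s}) ⟨?_, ?_, ?_, ?_⟩ s ?_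
    · ext v
      simp only [Finset.mem_union, Finset.mem_sdiff, Finset.mem_singleton, hX]
      grind
    · obtain ⟨z, hz, hzs⟩ := Finset.not_subset.mp hZs
      exact ⟨z, by simp_all⟩
    · exact ⟨t, by simp [hX, htA, htZ]⟩
    · intro x y hxy hx hxB hy
      simp only [Finset.mem_union, Finset.mem_sdiff, Finset.mem_singleton, hX] at hxB hy
      by_cases hyB : y ∈ B
      · exact hcross x y hxy hx hyB
      · have hyA : y ∈ A := by grind
        have := hedge y x (by rwa [Sym2.eq_swap]) hyA hyB (hZ hx)
        grind
    · intro v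
      simp only [Finset.mem_inter, Finset.mem_union, Finset.mem_sdiff, Finset.mem_singleton]
      grind

end Separation

theorem Torso.hasDecomp {G : MG V}
    (hirr : ∀ X H π, Torso G X H π → 5 ≤ X.card →
      (∀ A B, Separation X H A B → 3 ≤ (A ∩ B).card) → False) (n : ℕ) :
    ∀ X H π, X.card = n → Torso G X H π → HasDecomp X {e | e ∈ H} := by
  induction n using Nat.strong_induction_on with
  | _ n ih =>
  intro X H π hn h
  have glue : ∀ A B s t s' t', Separation X H A B → s ∈ A → t ∈ A → s' ∈ B → t' ∈ B →
      (∀ v ∈ A, v ∈ B → v = s ∨ v = t) → (∀ v ∈ A, v ∈ B → v = s' ∨ v = t') →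
      (s ≠ t → ∃ E S, Trail s t E S ∧ E ≤ (H.filter fun e => ∀ v ∈ e, v ∈ B).val) →
      (s' ≠ t' → ∃ E S, Trail s' t' E S ∧ E ≤ (H.filter fun e => ∀ v ∈ e, v ∈ A).val) →
      HasDecomp X {e | e ∈ H} := by
    have side : ∀ A B s t, Separation X H A B → s ∈ A → t ∈ A →
        (∀ v ∈ A, v ∈ B → v = s ∨ v = t) →
        (s ≠ t → ∃ E S, Trail s t E S ∧ E ≤ (H.filter fun e => ∀ v ∈ e, v ∈ B).val) →
        ∃ K, HasDecomp A K ∧ s(s, t) ∈ K ∧ ∀ e ∈ H, (∀ v ∈ e, v ∈ A) → e ∈ K := by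
      intro A B s t hsep hs ht hst htr
      refine ⟨_, (ih _ (hn ▸ hsep.card_lt) A _ _ rfl
        (h.restrict hsep hs ht hst htr)).insert_diag hs, ?_, fun e he heA => ?_⟩
      · by_cases hst' : s = t <;> simp [sideEdges, hst']
      · exact .inr (by simpa [sideEdges, he] using Or.inl heA)
    intro A B s t s' t' hsep hs ht hs' ht' hst hst' htr htr'
    obtain ⟨K, hK, hKe, hKH⟩ := side A B s t hsep hs ht hst htr
    obtain ⟨K', hK', hKe', hKH'⟩ := side B A s' t' hsep.symm hs' ht'
      (fun v hv hv' => hst' v hv' hv) htr'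
    refine hK.glue hK' hsep.union.symm (fun e he => ?_) ⟨_, hKe, fun v hv => ?_⟩
      ⟨_, hKe', fun v hv => ?_⟩
    · by_cases heA : ∀ v ∈ e, v ∈ A
      · exact .inl (hKH e he heA)
      · refine .inr (hKH' e he ?_)
        have hmem := h.mem e he
        have hX : ∀ v, v ∈ X → v ∈ A ∨ v ∈ B := fun v hv => by
          rwa [← hsep.union, Finset.mem_union] at hv
        have hedge := hsep.edge
        induction e with | _ x y
        simp only [Sym2.mem_iff, forall_eq_or_imp, forall_eq] at heA hmem ⊢
        have := hedge x y he
        have := hedge y x (by rwa [Sym2.eq_swap])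
        grind
    · rw [Finset.mem_inter] at hv
      simpa using hst v hv.1 hv.2
    · rw [Finset.mem_inter] at hv
      simpa using hst' v hv.1 hv.2
  by_cases h₁ : ∃ A B, Separation X H A B ∧ (A ∩ B).card ≤ 1
  · obtain ⟨A, B, hsep, hcard⟩ := h₁
    have hone := Finset.card_le_one.mp hcard
    obtain ⟨a, ha⟩ := hsep.left
    obtain ⟨b, hb⟩ := hsep.right
    rw [Finset.mem_sdiff] at ha hb
    obtain ⟨s, hs, s', hs', hst⟩ : ∃ s ∈ A, ∃ s' ∈ B, ∀ v ∈ A, v ∈ B → v = s ∧ v = s' := by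
      by_cases hne : (A ∩ B).Nonempty
      · obtain ⟨s, hs⟩ := hne
        have hs' := Finset.mem_inter.mp hs
        refine ⟨s, hs'.1, s, hs'.2, fun v hv hv' => ?_⟩
        simpa using hone v (Finset.mem_inter.mpr ⟨hv, hv'⟩) s hs
      · exact ⟨a, ha.1, b, hb.1, fun v hv hv' =>
          (hne ⟨v, Finset.mem_inter.mpr ⟨hv, hv'⟩⟩).elim⟩
    exact glue A B s s s' s' hsep hs hs hs' hs' (fun v hv hv' => .inl (hst v hv hv').1)
      (fun v hv hv' => .inl (hst v hv hv').2) (fun h => (h rfl).elim) fun h => (h rfl).elim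
  push Not at h₁
  by_cases h₂ : ∃ A B, Separation X H A B ∧ (A ∩ B).card = 2
  · obtain ⟨A, B, hsep, hcard⟩ := h₂
    obtain ⟨s, t, hst, hAB⟩ := Finset.card_eq_two.mp hcard
    have hmem : ∀ v, v ∈ A ∧ v ∈ B ↔ v = s ∨ v = t := fun v => by
      rw [← Finset.mem_inter, hAB]
      simp
    obtain ⟨hsA, hsB⟩ := (hmem s).mpr (.inl rfl)
    obtain ⟨htA, htB⟩ := (hmem t).mpr (.inr rfl)
    exact glue A B s t s t hsep hsA htA hsB htB (fun v hv hv' => (hmem v).mp ⟨hv, hv'⟩)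
      (fun v hv hv' => (hmem v).mp ⟨hv, hv'⟩) (fun _ => hsep.exists_trail hAB hst h₁)
      fun _ => hsep.symm.exists_trail (by rwa [Finset.inter_comm]) hst h₁
  push Not at h₂
  by_cases h₄ : X.card ≤ 4
  · exact .of_card_le h₄ h.mem
  · refine (hirr X H π h (by omega) fun A B hsep => ?_).elim
    have := h₁ A B hsep
    have := h₂ A B hsep
    omega

theorem Torso.refl (G : MG V) : Torso G G.verts G.edges.toFinset fun v => s(v, v) where
  sub := subset_rfl
  mem e he := G.edge_support e (Multiset.mem_toFinset.mp he)
  loopless e he := G.loopless e (Multiset.mem_toFinset.mp he)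
  proj_self _ _ := rfl
  proj v hv hv' := absurd hv hv'
  adj_mem v w hvw _ _ := Multiset.mem_toFinset.mpr hvw
  adj_eq v w hvw hv _ := absurd (G.edge_support _ hvw v (by simp)) hv
  adj_attach v w hvw hv _ := absurd (G.edge_support _ hvw v (by simp)) hv
  trail a b hab := by
    refine ⟨_, _, .single a b, ?_⟩
    rw [Multiset.singleton_le, piece, Multiset.mem_filter]
    exact ⟨Multiset.mem_toFinset.mp hab, fun v hv => .inl hv⟩

/-- The number of edges of `H` joining `P` to `Q`, for disjoint `P` and `Q`. -/
def crossNum (H : Finset (Sym2 V)) (P Q : Finset V) : ℕ :=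
  ∑ x ∈ P, ∑ y ∈ Q, if s(x, y) ∈ H then 1 else 0

theorem crossNum_comm (H : Finset (Sym2 V)) (P Q : Finset V) :
    crossNum H P Q = crossNum H Q P := by
  rw [crossNum, Finset.sum_comm]
  simp_rw [Sym2.eq_swap]
  rfl

theorem crossNum_eq_sum (H : Finset (Sym2 V)) (X : Finset V) {k : ℕ} (c : V → Fin k)
    (S T : Finset (Fin k)) :
    crossNum H (X.filter (c · ∈ S)) (X.filter (c · ∈ T)) =
      ∑ i ∈ S, ∑ j ∈ T, crossNum H (X.filter (c · = i)) (X.filter (c · = j)) := by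
  have key : ∀ (S : Finset (Fin k)) (f : V → ℕ),
      ∑ x ∈ X.filter (c · ∈ S), f x = ∑ i ∈ S, ∑ x ∈ X.filter (c · = i), f x := by
    intro S f
    rw [← Finset.sum_fiberwise_of_maps_to (t := S) (g := c)
      fun x hx => (Finset.mem_filter.mp hx).2]
    refine Finset.sum_congr rfl fun i hi => Finset.sum_congr ?_ fun _ _ => rfl
    ext x
    simp only [Finset.mem_filter]
    grind
  simp_rw [crossNum, key]
  exact Finset.sum_congr rfl fun i _ => Finset.sum_comm

theorem card_cross (H : Finset (Sym2 V)) {P Q : Finset V} (hd : Disjoint P Q) :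
    (H.filter fun e => ∃ x ∈ P, ∃ y ∈ Q, e = s(x, y)).card = crossNum H P Q := by
  rw [crossNum, ← Finset.sum_product', ← Finset.card_filter]
  symm
  refine Finset.card_bij (fun p _ => s(p.1, p.2)) ?_ ?_ ?_
  · rintro ⟨x, y⟩ hp
    simp only [Finset.mem_filter, Finset.mem_product] at hp ⊢
    exact ⟨hp.2, x, hp.1.1, y, hp.1.2, rfl⟩
  · rintro ⟨x, y⟩ hp ⟨x', y'⟩ hp' heq
    simp only [Finset.mem_filter, Finset.mem_product] at hp hp'
    rcases Sym2.eq_iff.mp heq with ⟨rfl, rfl⟩ | ⟨rfl, rfl⟩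
    · rfl
    · exact (Finset.disjoint_left.mp hd hp.1.1 hp'.1.2).elim
  · intro e he
    obtain ⟨heH, x, hx, y, hy, rfl⟩ := Finset.mem_filter.mp he
    exact ⟨(x, y), by simp [hx, hy, heH], rfl⟩

theorem crossNum_pos {H : Finset (Sym2 V)} {P Q : Finset V} (h : 0 < crossNum H P Q) :
    P.Nonempty := by
  by_contra hP
  rw [Finset.not_nonempty_iff_eq_empty.mp hP] at h
  simp [crossNum] at h

/-- `H` is the edge set of a simple `3`-connected graph on `X`. -/
structure ThreeConn (X : Finset V) (H : Finset (Sym2 V)) : Prop where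
  mem : ∀ e ∈ H, ∀ v ∈ e, v ∈ X
  loopless : ∀ e ∈ H, ¬ e.IsDiag
  five_le : 5 ≤ X.card
  three_le : ∀ A B, Separation X H A B → 3 ≤ (A ∩ B).card

namespace ThreeConn

variable {X : Finset V} {H : Finset (Sym2 V)}

theorem le_crossNum (h : ThreeConn X H) {P Q C : Finset V} (hX : P ∪ Q ∪ C = X)
    (hPQ : Disjoint P Q) (hPC : Disjoint P C) (hQC : Disjoint Q C) (hQ : Q.Nonempty)
    (hP : crossNum H P Q < P.card) : 3 ≤ C.card + crossNum H P Q := by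
  set D := P.filter fun x => ∃ y ∈ Q, s(x, y) ∈ H with hD
  have hDcard : D.card ≤ crossNum H P Q := by
    rw [hD, Finset.card_filter, crossNum]
    refine Finset.sum_le_sum fun x _ => ?_
    split_ifs with hx
    · obtain ⟨y, hy, hxy⟩ := hx
      refine le_trans ?_ (Finset.single_le_sum (f := fun y => if s(x, y) ∈ H then 1 else 0)
        (fun _ _ => Nat.zero_le _) hy)
      simp [hxy]
    · exact Nat.zero_le _
  have hsep : Separation X H (P ∪ C) (Q ∪ C ∪ D) := by
    rw [Finset.disjoint_left] at hPQ hPC hQC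
    refine ⟨?_, ?_, ?_, ?_⟩
    · rw [← hX]
      ext v
      simp only [Finset.mem_union, hD, Finset.mem_filter]
      tauto
    · obtain ⟨x, hx, hxD⟩ := Finset.exists_mem_notMem_of_card_lt_card (hDcard.trans_lt hP)
      refine ⟨x, ?_⟩
      simp only [Finset.mem_sdiff, Finset.mem_union]
      have := hPQ hx
      have := hPC hx
      tauto
    · obtain ⟨y, hy⟩ := hQ
      refine ⟨y, ?_⟩
      simp only [Finset.mem_sdiff, Finset.mem_union]
      have := hQC hy
      have : y ∉ P := fun hy' => hPQ hy' hy
      tauto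
    · intro x y hxy hx hx' hy
      simp only [Finset.mem_union, hD, Finset.mem_filter, not_or, not_and] at hx hx' hy ⊢
      grind
  have := h.three_le _ _ hsep
  have hle : ((P ∪ C) ∩ (Q ∪ C ∪ D)).card ≤ C.card + D.card := by
    refine (Finset.card_le_card fun v hv => ?_).trans (Finset.card_union_le C D)
    rw [Finset.disjoint_left] at hPQ
    simp only [Finset.mem_inter, Finset.mem_union] at hv ⊢
    have := @hPQ v
    tauto
  omega

theorem le_crossNum_of_add (h : ThreeConn X H) {P Q C : Finset V} (hX : P ∪ Q ∪ C = X)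
    (hPQ : Disjoint P Q) (hPC : Disjoint P C) (hQC : Disjoint Q C) (hP : P.Nonempty)
    (hQ : Q.Nonempty) (hC : C.card ≤ 1) : 3 ≤ C.card + crossNum H P Q := by
  by_contra! hlt
  have h₁ := h.le_crossNum hX hPQ hPC hQC hQ
  have h₂ := h.le_crossNum (by rw [← hX, Finset.union_comm Q P]) hPQ.symm hQC hPC hP
  rw [crossNum_comm H Q P] at h₂
  have h₃ := h.five_le
  rw [← hX, Finset.card_union_of_disjoint (Finset.disjoint_union_left.mpr ⟨hPC, hQC⟩),
    Finset.card_union_of_disjoint hPQ] at h₃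
  omega

theorem three_le_cut (h : ThreeConn X H) {P : Finset V} (hPX : P ⊆ X) (hP : P.Nonempty)
    (hP' : (X \ P).Nonempty) : 3 ≤ crossNum H P (X \ P) := by
  simpa using h.le_crossNum_of_add (C := ∅) (by simpa using hPX) Finset.disjoint_sdiff
    (by simp) (by simp) hP hP' (by simp)

theorem three_le_color (h : ThreeConn X H) {k : ℕ} (c : V → Fin k) (S : Finset (Fin k))
    {i j : Fin k} (hi : i ∈ S) (hj : j ∉ S) (hi' : (X.filter (c · = i)).Nonempty)
    (hj' : (X.filter (c · = j)).Nonempty) :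
    3 ≤ ∑ i ∈ S, ∑ j ∈ Sᶜ, crossNum H (X.filter (c · = i)) (X.filter (c · = j)) := by
  have hc : X.filter (c · ∈ Sᶜ) = X \ X.filter (c · ∈ S) := by
    ext v
    simp
    tauto
  rw [← crossNum_eq_sum, hc]
  refine h.three_le_cut (Finset.filter_subset _ _) ?_ ?_
  · refine hi'.mono fun v hv => ?_
    rw [Finset.mem_filter] at hv ⊢
    exact ⟨hv.1, hv.2 ▸ hi⟩
  · rw [← hc]
    refine hj'.mono fun v hv => ?_
    rw [Finset.mem_filter] at hv ⊢
    exact ⟨hv.1, by rw [hv.2]; simpa using hj⟩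

/-- The neighbours of `v` in `H`. -/
def _root_.PaperW4.nbrs (X : Finset V) (H : Finset (Sym2 V)) (v : V) : Finset V :=
  X.filter fun w => s(v, w) ∈ H

theorem crossNum_singleton (h : ThreeConn X H) (v : V) :
    crossNum H {v} (X \ {v}) = (nbrs X H v).card := by
  rw [crossNum, Finset.sum_singleton, ← Finset.card_filter, nbrs]
  congr 1
  ext w
  simp only [Finset.mem_filter, Finset.mem_sdiff, Finset.mem_singleton]
  refine ⟨fun hw => ⟨hw.1.1, hw.2⟩, fun hw => ⟨⟨hw.1, ?_⟩, hw.2⟩⟩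
  rintro rfl
  exact h.loopless _ hw.2 (by simp)

end ThreeConn

/-- Deleting `x` and `y` from `H` leaves a graph without cut-edges. -/
def Good (X : Finset V) (H : Finset (Sym2 V)) (x y : V) : Prop :=
  ∀ P Q, P ∪ Q = X \ {x, y} → Disjoint P Q → P.Nonempty → Q.Nonempty → 2 ≤ crossNum H P Q

theorem quadrants_contradiction {m : Fin 6 → Fin 6 → ℕ} (hm : ∀ i j, m i j = m j i)
    {ne : Fin 6 → Prop} (hne : ∀ i j, 0 < m i j → ne i)
    (hcut : ∀ S : Finset (Fin 6), ∀ i ∈ S, ∀ j ∉ S, ne i → ne j → 3 ≤ ∑ i ∈ S, ∑ j ∈ Sᶜ, m i j)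
    (h₀ : ∑ j ∈ {0}ᶜ, m 0 j = 3) (h₁ : ∑ j ∈ {1}ᶜ, m 1 j = 3) (h₀₁ : m 0 1 = 1)
    (hP : ne 2 ∨ ne 4) (hP' : ne 3 ∨ ne 5) (hQ : ne 2 ∨ ne 3) (hQ' : ne 4 ∨ ne 5)
    (hcross : ∑ i ∈ {2, 4}, ∑ j ∈ {3, 5}, m i j ≤ 1)
    (hcutQ : ∑ i ∈ {0, 2, 3}, ∑ j ∈ {0, 2, 3}ᶜ, m i j ≤ 3) : False := by
  have n₀ : ne 0 := hne 0 1 (by omega)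
  have n₁ : ne 1 := hne 1 0 (by rw [hm]; omega)
  have cut : ∀ S : Finset (Fin 6), 0 ∉ S → (∃ i ∈ S, ne i) → 3 ≤ ∑ i ∈ S, ∑ j ∈ Sᶜ, m i j :=
    fun S hS ⟨i, hi, hi'⟩ => hcut S i hi 0 hS hi' n₀
  have cP := cut {2, 4} (by decide) (by simpa using hP)
  have cP' := cut {3, 5} (by decide) (by simpa using hP')
  have cQ := cut {2, 3} (by decide) (by simpa using hQ)
  have cQ' := cut {4, 5} (by decide) (by simpa using hQ')
  have cPb := cut {1, 2, 4} (by decide) ⟨1, by simp, n₁⟩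
  have cPb' := cut {1, 3, 5} (by decide) ⟨1, by simp, n₁⟩
  have c₂ := fun h => cut {2} (by decide) ⟨2, by simp, h⟩
  have c₃ := fun h => cut {3} (by decide) ⟨3, by simp, h⟩
  have c₄ := fun h => cut {4} (by decide) ⟨4, by simp, h⟩
  have c₅ := fun h => cut {5} (by decide) ⟨5, by simp, h⟩
  have p₂ : 0 < m 0 2 → ne 2 := fun h => hne 2 0 (by rwa [hm])
  have p₃ : 0 < m 0 3 → ne 3 := fun h => hne 3 0 (by rwa [hm])
  have p₄ : 0 < m 1 4 → ne 4 := fun h => hne 4 1 (by rwa [hm])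
  have p₅ : 0 < m 1 5 → ne 5 := fun h => hne 5 1 (by rwa [hm])
  simp only [show ({0}ᶜ : Finset (Fin 6)) = {1, 2, 3, 4, 5} by decide,
    show ({1}ᶜ : Finset (Fin 6)) = {0, 2, 3, 4, 5} by decide,
    show ({2}ᶜ : Finset (Fin 6)) = {0, 1, 3, 4, 5} by decide,
    show ({3}ᶜ : Finset (Fin 6)) = {0, 1, 2, 4, 5} by decide,
    show ({4}ᶜ : Finset (Fin 6)) = {0, 1, 2, 3, 5} by decide,
    show ({5}ᶜ : Finset (Fin 6)) = {0, 1, 2, 3, 4} by decide,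
    show ({2, 4}ᶜ : Finset (Fin 6)) = {0, 1, 3, 5} by decide,
    show ({3, 5}ᶜ : Finset (Fin 6)) = {0, 1, 2, 4} by decide,
    show ({2, 3}ᶜ : Finset (Fin 6)) = {0, 1, 4, 5} by decide,
    show ({4, 5}ᶜ : Finset (Fin 6)) = {0, 1, 2, 3} by decide,
    show ({1, 2, 4}ᶜ : Finset (Fin 6)) = {0, 3, 5} by decide,
    show ({1, 3, 5}ᶜ : Finset (Fin 6)) = {0, 2, 4} by decide,
    show ({0, 2, 3}ᶜ : Finset (Fin 6)) = {1, 4, 5} by decide] at *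
  simp [Finset.sum_insert] at h₀ h₁ hcross hcutQ cP cP' cQ cQ' cPb cPb' c₂ c₃ c₄ c₅
  rw [hm 1 0] at *
  rw [hm 2 0, hm 2 1, hm 4 0, hm 4 1] at *
  rw [hm 3 0, hm 3 1, hm 5 0, hm 5 1] at *
  rw [hm 3 2, hm 5 2, hm 5 4, hm 4 2, hm 4 3, hm 5 3] at *
  have e₁ : m 0 2 + m 0 4 = 1 := by omega
  have e₂ : m 1 2 + m 1 4 = 1 := by omega
  have e₃ : m 0 4 = 0 := by omega
  have e₄ : m 0 5 = 0 := by omega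
  have e₅ : m 1 2 = 0 := by omega
  have e₆ : m 1 3 = 0 := by omega
  have := c₂ (p₂ (by omega))
  have := c₃ (p₃ (by omega))
  have := c₄ (p₄ (by omega))
  have := c₅ (p₅ (by omega))
  omega

theorem cuts_le_three {m : Fin 4 → Fin 4 → ℕ} (hm : ∀ i j, m i j = m j i)
    (h₀ : ∑ j ∈ {0}ᶜ, m 0 j = 3) (h₁ : ∑ j ∈ {1}ᶜ, m 1 j = 3) (h₀₁ : m 0 1 = 1)
    (hlt : ¬ 2 ≤ ∑ i ∈ {2}, ∑ j ∈ {3}, m i j) (h₂ : 3 ≤ ∑ i ∈ {2}, ∑ j ∈ {2}ᶜ, m i j)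
    (h₃ : 3 ≤ ∑ i ∈ {3}, ∑ j ∈ {3}ᶜ, m i j) :
    ∑ i ∈ {2}, ∑ j ∈ {2}ᶜ, m i j ≤ 3 ∧ ∑ i ∈ {3}, ∑ j ∈ {3}ᶜ, m i j ≤ 3 := by
  simp only [show ({0}ᶜ : Finset (Fin 4)) = {1, 2, 3} by decide,
    show ({1}ᶜ : Finset (Fin 4)) = {0, 2, 3} by decide,
    show ({2}ᶜ : Finset (Fin 4)) = {0, 1, 3} by decide,
    show ({3}ᶜ : Finset (Fin 4)) = {0, 1, 2} by decide] at *
  simp [Finset.sum_insert] at h₀ h₁ hlt h₂ h₃ ⊢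
  have := hm 1 0
  have := hm 2 0
  have := hm 2 1
  have := hm 3 0
  have := hm 3 1
  have := hm 3 2
  omega

namespace ThreeConn

variable {X : Finset V} {H : Finset (Sym2 V)}

theorem crossNum_color_singleton (h : ThreeConn X H) {k : ℕ} {c : V → Fin k} {i : Fin k} {a : V}
    (ha : a ∈ X) (hc : ∀ v, c v = i ↔ v = a) :
    ∑ j ∈ {i}ᶜ, crossNum H (X.filter (c · = i)) (X.filter (c · = j)) = (nbrs X H a).card := by
  have := crossNum_eq_sum H X c {i} {i}ᶜ
  rw [Finset.sum_singleton] at this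
  rw [← h.crossNum_singleton, ← this]
  congr 1 <;> ext v <;> simp only [Finset.mem_filter, Finset.mem_singleton, Finset.mem_compl,
    Finset.mem_sdiff, hc]
  grind

theorem sum_color_eq {k : ℕ} {c : V → Fin k} (S T : Finset (Fin k)) {P Q : Finset V}
    (hP : ∀ v, v ∈ X ∧ c v ∈ S ↔ v ∈ P) (hQ : ∀ v, v ∈ X ∧ c v ∈ T ↔ v ∈ Q) :
    ∑ i ∈ S, ∑ j ∈ T, crossNum H (X.filter (c · = i)) (X.filter (c · = j)) = crossNum H P Q := by
  rw [← crossNum_eq_sum]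
  congr 1 <;> ext v <;> simp only [Finset.mem_filter, hP, hQ]

theorem crossNum_color_eq_one {k : ℕ} {c : V → Fin k} {i j : Fin k} {a b : V} (hab : s(a, b) ∈ H)
    (ha : a ∈ X) (hb : b ∈ X) (hi : ∀ v, c v = i ↔ v = a) (hj : ∀ v, c v = j ↔ v = b) :
    crossNum H (X.filter (c · = i)) (X.filter (c · = j)) = 1 := by
  have hs : ∀ {i : Fin k} {a : V}, a ∈ X → (∀ v, c v = i ↔ v = a) → X.filter (c · = i) = {a} := by
    intro i a ha hi
    ext v
    simp only [Finset.mem_filter, hi, Finset.mem_singleton, and_iff_right_iff_imp]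
    rintro rfl
    exact ha
  rw [hs ha hi, hs hb hj]
  rw [crossNum, Finset.sum_singleton, Finset.sum_singleton, if_pos hab]

theorem good_of_cut (h : ThreeConn X H) (hdeg : ∀ v ∈ X, (nbrs X H v).card = 3) {Q : Finset V}
    (hQX : Q ⊆ X) (hQ : 2 ≤ Q.card) (hQ' : 2 ≤ (X \ Q).card) (hcut : crossNum H Q (X \ Q) ≤ 3)
    {a b : V} (hab : s(a, b) ∈ H) (ha : a ∈ Q) (hb : b ∉ Q) : Good X H a b := by
  intro P P' hPP hd hP hP'
  by_contra! hlt
  have haX := hQX ha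
  have hbX := h.mem _ hab b (by simp)
  have hne : a ≠ b := by rintro rfl; exact hb ha
  have hmem : ∀ v, v ∈ P ∨ v ∈ P' ↔ v ∈ X ∧ v ≠ a ∧ v ≠ b := fun v => by
    rw [← Finset.mem_union, hPP]
    simp
  rw [Finset.disjoint_left] at hd
  set c : V → Fin 6 := fun v => if v = a then 0 else if v = b then 1 else
    if v ∈ P then (if v ∈ Q then 2 else 4) else (if v ∈ Q then 3 else 5) with hc
  have c₀ : ∀ v, c v = 0 ↔ v = a := fun v => by simp only [hc]; split_ifs <;> simp_all
  have c₁ : ∀ v, c v = 1 ↔ v = b := fun v => by simp only [hc]; split_ifs <;> simp_all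
  have ne : ∀ {i j v}, v ∈ X → c v = i ∨ c v = j →
      (X.filter (c · = i)).Nonempty ∨ (X.filter (c · = j)).Nonempty := fun hv hcv =>
    hcv.imp (fun hcv => ⟨_, Finset.mem_filter.mpr ⟨hv, hcv⟩⟩)
      fun hcv => ⟨_, Finset.mem_filter.mpr ⟨hv, hcv⟩⟩
  refine quadrants_contradiction (m := fun i j => crossNum H (X.filter (c · = i))
    (X.filter (c · = j))) (ne := fun i => (X.filter (c · = i)).Nonempty)
    (fun i j => crossNum_comm H _ _) (fun i j => crossNum_pos)
    (fun S i hi j hj hi' hj' => h.three_le_color c S hi hj hi' hj')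
    (by rw [h.crossNum_color_singleton haX c₀, hdeg a haX])
    (by rw [h.crossNum_color_singleton hbX c₁, hdeg b hbX])
    (crossNum_color_eq_one hab haX hbX c₀ c₁) ?_ ?_ ?_ ?_ ?_ ?_
  · obtain ⟨v, hv⟩ := hP
    have := (hmem v).mp (.inl hv)
    refine ne this.1 ?_
    simp only [hc, if_neg this.2.1, if_neg this.2.2, if_pos hv]
    split_ifs <;> simp
  · obtain ⟨v, hv⟩ := hP'
    have := (hmem v).mp (.inr hv)
    refine ne this.1 ?_
    simp only [hc, if_neg this.2.1, if_neg this.2.2, if_neg fun hv' => hd hv' hv]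
    split_ifs <;> simp
  · obtain ⟨v, hv, hva⟩ := Finset.exists_mem_ne hQ a
    have hvb : v ≠ b := by rintro rfl; exact hb hv
    refine ne (hQX hv) ?_
    simp only [hc, if_neg hva, if_neg hvb, if_pos hv]
    split_ifs <;> simp
  · obtain ⟨v, hv, hvb⟩ := Finset.exists_mem_ne hQ' b
    rw [Finset.mem_sdiff] at hv
    have hva : v ≠ a := by rintro rfl; exact hv.2 ha
    refine ne hv.1 ?_
    simp only [hc, if_neg hva, if_neg hvb, if_neg hv.2]
    split_ifs <;> simp
  · rw [sum_color_eq {2, 4} {3, 5} (P := P) (Q := P')]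
    · omega
    all_goals
      intro v
      have := hmem v
      have := @hd v
      simp only [hc]
      split_ifs <;> simp <;> grind
  · rw [sum_color_eq {0, 2, 3} {0, 2, 3}ᶜ (P := Q) (Q := X \ Q)]
    · exact hcut
    all_goals
      intro v
      have := @hQX v
      simp only [hc]
      split_ifs <;> simp <;> grind

theorem exists_cut_of_not_good (h : ThreeConn X H) (hdeg : ∀ v ∈ X, (nbrs X H v).card = 3)
    {a b : V} (hab : s(a, b) ∈ H) (hgood : ¬ Good X H a b) :
    ∃ Q ⊆ X, 2 ≤ Q.card ∧ 2 ≤ (X \ Q).card ∧ crossNum H Q (X \ Q) ≤ 3 := by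
  simp only [Good, not_forall] at hgood
  obtain ⟨P, P', hPP, hd, hP, hP', hlt⟩ := hgood
  have haX := h.mem _ hab a (by simp)
  have hbX := h.mem _ hab b (by simp)
  have hne : a ≠ b := by simpa using h.loopless _ hab
  have hmem : ∀ v, v ∈ P ∨ v ∈ P' ↔ v ∈ X ∧ v ≠ a ∧ v ≠ b := fun v => by
    rw [← Finset.mem_union, hPP]
    simp
  have hPX : P ⊆ X := fun v hv => ((hmem v).mp (.inl hv)).1
  have hPX' : P' ⊆ X := fun v hv => ((hmem v).mp (.inr hv)).1
  have hsub : {a, b} ⊆ X \ P := by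
    have := hmem a
    have := hmem b
    simp [Finset.insert_subset_iff]
    tauto
  have hsub' : {a, b} ⊆ X \ P' := by
    have := hmem a
    have := hmem b
    simp [Finset.insert_subset_iff]
    tauto
  have hcard := Finset.card_le_card hsub
  have hcard' := Finset.card_le_card hsub'
  have hsum : P.card + P'.card + 2 = X.card := by
    rw [← Finset.card_union_of_disjoint hd, hPP, ← Finset.card_pair hne]
    exact Finset.card_sdiff_add_card_eq_card (by simp [Finset.insert_subset_iff, haX, hbX])
  rw [Finset.card_pair hne] at hcard hcard'
  have h₁ := h.three_le_cut hPX hP (Finset.card_pos.mp (by omega))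
  have h₂ := h.three_le_cut hPX' hP' (Finset.card_pos.mp (by omega))
  have hle : crossNum H P (X \ P) ≤ 3 ∧ crossNum H P' (X \ P') ≤ 3 := by
    rw [Finset.disjoint_left] at hd
    set c : V → Fin 4 := fun v => if v = a then 0 else if v = b then 1 else
      if v ∈ P then 2 else 3 with hc
    have c₀ : ∀ v, c v = 0 ↔ v = a := fun v => by simp only [hc]; split_ifs <;> simp_all
    have c₁ : ∀ v, c v = 1 ↔ v = b := fun v => by simp only [hc]; split_ifs <;> simp_all
    have hm := fun i j => crossNum_comm H (X.filter (c · = i)) (X.filter (c · = j))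
    have d₀ := h.crossNum_color_singleton haX c₀
    have d₁ := h.crossNum_color_singleton hbX c₁
    have hone := crossNum_color_eq_one hab haX hbX c₀ c₁
    rw [hdeg a haX] at d₀
    rw [hdeg b hbX] at d₁
    have hP : ∀ v, v ∈ X ∧ c v ∈ ({2} : Finset (Fin 4)) ↔ v ∈ P := fun v => by
      have := hmem v
      simp only [hc]
      split_ifs <;> simp <;> grind
    have hP' : ∀ v, v ∈ X ∧ c v ∈ ({3} : Finset (Fin 4)) ↔ v ∈ P' := fun v => by
      have := hmem v
      have := @hd v
      simp only [hc]
      split_ifs <;> simp <;> grind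
    have e₁ := sum_color_eq (H := H) {2} {3} hP hP'
    have e₂ := sum_color_eq (H := H) (Q := X \ P) {2} {2}ᶜ hP fun v => by
      rw [Finset.mem_sdiff, ← hP v, Finset.mem_compl]; tauto
    have e₃ := sum_color_eq (H := H) (Q := X \ P') {3} {3}ᶜ hP' fun v => by
      rw [Finset.mem_sdiff, ← hP' v, Finset.mem_compl]; tauto
    rw [← e₂, ← e₃]
    rw [← e₂] at h₁
    rw [← e₃] at h₂
    rw [← e₁] at hlt
    exact cuts_le_three hm d₀ d₁ hone hlt h₁ h₂
  by_cases hP2 : 2 ≤ P.card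
  · exact ⟨P, hPX, hP2, hcard, hle.1⟩
  · exact ⟨P', hPX', by have := h.five_le; omega, hcard', hle.2⟩

end ThreeConn

theorem TwoEdgeConn.of_crossNum {H : Finset (Sym2 V)} {U : Finset V} (hH : ∀ e ∈ H, ¬ e.IsDiag)
    (hU : ∀ Z ⊆ U, Z.Nonempty → (U \ Z).Nonempty → 2 ≤ crossNum H Z (U \ Z)) :
    TwoEdgeConn (H.filter fun e => ∀ v ∈ e, v ∈ U).val U where
  mem e he := (Finset.mem_filter.mp (Finset.mem_val.mp he)).2
  loopless e he := hH e (Finset.mem_filter.mp (Finset.mem_val.mp he)).1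
  cut Z hZU hZ hne := by
    have hZ' : (U \ Z).Nonempty :=
      Finset.sdiff_nonempty.mpr fun hUZ => hne (hZU.antisymm hUZ)
    refine (hU Z hZU hZ hZ').trans ?_
    rw [← card_cross H Finset.disjoint_sdiff, ← Finset.filter_val, Finset.card_val]
    refine Finset.card_le_card fun e he => ?_
    obtain ⟨heH, x, hx, y, hy, rfl⟩ := Finset.mem_filter.mp he
    rw [Finset.mem_sdiff] at hy
    rw [Finset.mem_filter, Finset.mem_filter]
    exact ⟨⟨heH, by simp [hZU hx, hy.1]⟩, x, y, rfl, hx, hy.2⟩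

namespace Torso

variable {G : MG V} {X : Finset V} {H : Finset (Sym2 V)} {π : V → Sym2 V}

theorem hasW4Immersion_of_four_nbrs (h : Torso G X H π) (hc : ThreeConn X H) {u : V} (hu : u ∈ X)
    (hN : 4 ≤ (nbrs X H u).card) : HasW4Immersion G := by
  obtain ⟨P, hP, hPle⟩ := h.exists_realisation
  have hE : TwoEdgeConn (H.filter fun e => ∀ v ∈ e, v ∈ X \ {u}).val (X \ {u}) := by
    refine .of_crossNum hc.loopless fun Z hZ hne hne' => ?_
    have := hc.le_crossNum_of_add (C := {u}) (P := Z) (Q := (X \ {u}) \ Z) ?_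
      Finset.disjoint_sdiff ?_ ?_ hne hne' (by simp)
    · rw [Finset.card_singleton] at this
      omega
    · rw [Finset.union_sdiff_of_subset hZ, Finset.sdiff_union_of_subset (by simpa using hu)]
    · exact Finset.disjoint_singleton_right.mpr fun h => by simpa using hZ h
    · exact Finset.disjoint_singleton_right.mpr (by simp)
  have hNX : nbrs X H u ⊆ X \ {u} := by
    intro v hv
    rw [nbrs, Finset.mem_filter] at hv
    have : u ≠ v := by simpa using hc.loopless _ hv.2
    simp [hv.1, this.symm]
  have hNH : ∀ v ∈ nbrs X H u, s(u, v) ∈ H := fun v hv => (Finset.mem_filter.mp hv).2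
  refine (hE.exists_wheel hNX hN).hasW4Immersion (u := u) (P := P) (f := fun n => P s(u, n)) hE.mem
    hNX (Finset.sdiff_subset.trans h.sub) (h.sub hu) (by simp)
    (fun x y hxy => hP x y (Finset.mem_filter.mp (Finset.mem_val.mp hxy)).1)
    (fun n hn => hP u n (hNH n hn)) ?_
  have himg : ∑ n ∈ nbrs X H u, P s(u, n) = ∑ e ∈ (nbrs X H u).image fun n => s(u, n), P e :=
    (Finset.sum_image fun x _ y _ hxy => by
      have : x = y ∨ u = y ∧ x = u := by simpa using hxy
      grind).symm
  rw [himg, ← Finset.sum, ← Finset.sum_union]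
  · refine h.sum_le (Finset.union_subset (Finset.filter_subset _ _) ?_) ?_
    · exact Finset.image_subset_iff.mpr hNH
    · intro e he
      refine hPle e ?_
      rcases Finset.mem_union.mp he with he | he
      · exact (Finset.mem_filter.mp he).1
      · obtain ⟨n, hn, rfl⟩ := Finset.mem_image.mp he
        exact hNH n hn
  · rw [Finset.disjoint_left]
    intro e he he'
    obtain ⟨n, hn, rfl⟩ := Finset.mem_image.mp he'
    simpa using (Finset.mem_filter.mp he).2 u (by simp)

/-- The part of `G` attached to the edge `e` can be split between the ends of `e` so that at most
one edge of `G` joins the two sides. -/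
def _root_.PaperW4.Thin (G : MG V) (π : V → Sym2 V) (e : Sym2 V) : Prop :=
  ∃ ρ : V → V, (∀ v, ρ v ∈ e) ∧ (∀ v ∈ e, ρ v = v) ∧
    ((piece G π e).filter fun g => Sym2.map ρ g = e).card ≤ 1

theorem exists_two_trails_of_not_thin (h : Torso G X H π) (h3 : EdgeConn G 3) {x y : V}
    (hxy : s(x, y) ∈ H) (hthin : ¬ Thin G π s(x, y)) :
    ∃ F₁ F₂ S₁ S₂, Trail x y F₁ S₁ ∧ Trail x y F₂ S₂ ∧ F₁ + F₂ ≤ piece G π s(x, y) := by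
  have hne : x ≠ y := by simpa using h.loopless _ hxy
  have hxX := h.mem _ hxy x (by simp)
  have hyX := h.mem _ hxy y (by simp)
  set U := G.verts.filter fun v => v ∈ s(x, y) ∨ π v = s(x, y) with hU
  suffices hcut : ∀ Z ⊆ U, Z.Nonempty → Disjoint Z {y} →
      2 ≤ ((piece G π s(x, y)).filter (Crosses Z)).card by
    have hxU : x ∈ U := by simp [hU, h.sub hxX]
    have hmem : ∀ e ∈ piece G π s(x, y), ∀ v ∈ e, v ∈ U := fun e he v hv => by
      obtain ⟨heG, he⟩ := Multiset.mem_filter.mp he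
      exact Finset.mem_filter.mpr ⟨G.edge_support e heG v hv, he v hv⟩
    obtain ⟨p, hp, q, hq, F₁, F₂, S₁, S₂, h₁, h₂, hF⟩ := exists_two_trails hmem
      (fun e he => G.loopless e (Multiset.mem_filter.mp he).1) hcut hxU
    obtain rfl := Finset.mem_singleton.mp hp
    obtain rfl := Finset.mem_singleton.mp hq
    exact ⟨F₁, F₂, S₁, S₂, h₁, h₂, hF⟩
  intro Z hZ hZne hyZ
  rw [Finset.disjoint_singleton_right] at hyZ
  by_cases hxZ : x ∈ Z
  · by_contra! hlt
    refine hthin ⟨fun v => if v ∈ Z then x else y, fun v => ?_, fun v hv => ?_, ?_⟩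
    · dsimp only
      split_ifs <;> simp
    · rcases Sym2.mem_iff.mp hv with rfl | rfl
      · exact if_pos hxZ
      · exact if_neg hyZ
    · refine le_trans (Multiset.card_le_card (Multiset.monotone_filter_right _ ?_))
        (Nat.le_of_lt_succ hlt)
      intro g hg
      induction g with | _ v w
      by_cases hv : v ∈ Z <;> by_cases hw : w ∈ Z <;> simp [hv, hw, hne, hne.symm] at hg
      · exact ⟨v, w, rfl, hv, hw⟩
      · exact ⟨w, v, Sym2.eq_swap, hw, hv⟩
  · have hZG : Z ⊆ G.verts := hZ.trans (Finset.filter_subset _ _)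
    have h₃ := h3 Z hZG hZne fun hZ' => hyZ (hZ' ▸ h.sub hyX)
    refine le_trans (by omega) (h₃.trans (Multiset.card_le_card ?_))
    refine Multiset.le_filter.mpr ⟨Multiset.le_filter.mpr ⟨Multiset.filter_le _ _, ?_⟩,
      fun g hg => (Multiset.mem_filter.mp hg).2⟩
    intro g hg
    obtain ⟨hgG, v, w, rfl, hv, hw⟩ := Multiset.mem_filter.mp hg
    have hvxy : v ∉ s(x, y) := by
      rw [Sym2.mem_iff]
      rintro (rfl | rfl) <;> contradiction
    have hπ : π v = s(x, y) := (Finset.mem_filter.mp (hZ hv)).2.resolve_left hvxy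
    have hvX : v ∉ X := by
      intro hvX
      rw [h.proj_self v hvX] at hπ
      exact hvxy (hπ ▸ Sym2.mem_mk_left v v)
    have hw : w ∈ s(x, y) ∨ π w = s(x, y) := by
      by_cases hwX : w ∈ X
      · exact .inl (hπ ▸ h.adj_attach v w hgG hvX hwX)
      · exact .inr (hπ ▸ (h.adj_eq v w hgG hvX hwX).symm)
    intro u hu
    rcases Sym2.mem_iff.mp hu with rfl | rfl
    · exact .inr hπ
    · exact hw

end Torso

theorem ThreeConn.notMem_nbrs_of_good {X : Finset V} {H : Finset (Sym2 V)} (h : ThreeConn X H)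
    (hdeg : ∀ v ∈ X, (nbrs X H v).card = 3) {x y n : V} (hgood : Good X H x y)
    (hxy : s(x, y) ∈ H) (hn : n ∈ nbrs X H x) : n ∉ nbrs X H y := by
  intro hn'
  rw [nbrs, Finset.mem_filter] at hn hn'
  have hxX := h.mem _ hxy x (by simp)
  have hyX := h.mem _ hxy y (by simp)
  have hne : x ≠ y := by simpa using h.loopless _ hxy
  have hnx : x ≠ n := by simpa using h.loopless _ hn.2
  have hny : y ≠ n := by simpa using h.loopless _ hn'.2
  have hcard := Finset.le_card_sdiff {x, y, n} X
  have hfive := h.five_le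
  have hthree := Finset.card_le_three (a := x) (b := y) (c := n)
  have h₂ := hgood {n} (X \ {x, y, n}) ?_ (by simp) (by simp) (Finset.card_pos.mp (by omega))
  · rw [crossNum, Finset.sum_singleton, ← Finset.card_filter] at h₂
    have hsub : {x, y} ∪ (X \ {x, y, n}).filter (fun v => s(n, v) ∈ H) ⊆ nbrs X H n := by
      intro v hv
      simp only [nbrs, Finset.mem_filter, Finset.mem_union, Finset.mem_insert,
        Finset.mem_singleton, Finset.mem_sdiff] at hv ⊢
      rcases hv with (rfl | rfl) | hv
      · exact ⟨hxX, by rw [Sym2.eq_swap]; exact hn.2⟩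
      · exact ⟨hyX, by rw [Sym2.eq_swap]; exact hn'.2⟩
      · exact ⟨hv.1.1, hv.2⟩
    have hle := Finset.card_le_card hsub
    rw [Finset.card_union_of_disjoint, Finset.card_pair hne, hdeg n hn.1] at hle
    · omega
    · rw [Finset.disjoint_left]
      intro v hv hv'
      simp only [Finset.mem_filter, Finset.mem_insert, Finset.mem_singleton,
        Finset.mem_sdiff] at hv hv'
      tauto
  · ext v
    simp only [Finset.mem_union, Finset.mem_insert, Finset.mem_singleton, Finset.mem_sdiff]
    grind

theorem ThreeConn.exists_two_nbrs {X : Finset V} {H : Finset (Sym2 V)} (h : ThreeConn X H)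
    (hdeg : ∀ v ∈ X, (nbrs X H v).card = 3) {x y : V} (hxy : s(x, y) ∈ H) :
    ∃ n₁ n₂, n₁ ≠ n₂ ∧ ∀ n ∈ [n₁, n₂], n ∈ nbrs X H x ∧ n ∈ X ∧ s(x, n) ∈ H ∧ n ≠ x ∧ n ≠ y := by
  have hxX := h.mem _ hxy x (by simp)
  have hy : y ∈ nbrs X H x := Finset.mem_filter.mpr ⟨h.mem _ hxy y (by simp), hxy⟩
  obtain ⟨n₁, n₂, hne, hN⟩ := Finset.card_eq_two.mp
    ((Finset.card_erase_of_mem hy).trans (by rw [hdeg x hxX]))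
  refine ⟨n₁, n₂, hne, fun n hn => ?_⟩
  have hn : n ∈ (nbrs X H x).erase y := by
    rw [hN]
    simpa using hn
  have hn' := Finset.mem_of_mem_erase hn
  obtain ⟨hnX, hnH⟩ := Finset.mem_filter.mp hn'
  have hnx : x ≠ n := by simpa using h.loopless _ hnH
  exact ⟨hn', hnX, hnH, hnx.symm, Finset.ne_of_mem_erase hn⟩

namespace Torso

variable {G : MG V} {X : Finset V} {H : Finset (Sym2 V)} {π : V → Sym2 V}

theorem hasW4Immersion_of_good (h : Torso G X H π) (h3 : EdgeConn G 3) (hc : ThreeConn X H)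
    (hdeg : ∀ v ∈ X, (nbrs X H v).card = 3) {x y : V} (hxy : s(x, y) ∈ H) (hgood : Good X H x y)
    (hthin : ¬ Thin G π s(x, y)) : HasW4Immersion G := by
  obtain ⟨P, hP, hPle⟩ := h.exists_realisation
  obtain ⟨F₁, F₂, S₁, S₂, hF₁, hF₂, hF⟩ := h.exists_two_trails_of_not_thin h3 hxy hthin
  have hyx : s(y, x) ∈ H := by rwa [Sym2.eq_swap]
  have hne : x ≠ y := by simpa using h.loopless _ hxy
  obtain ⟨n₁, n₂, h₁₂, hx⟩ := hc.exists_two_nbrs hdeg hxy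
  obtain ⟨n₃, n₄, h₃₄, hy⟩ := hc.exists_two_nbrs hdeg hyx
  have hdisj : ∀ n ∈ [n₁, n₂], ∀ n' ∈ [n₃, n₄], n ≠ n' := by
    rintro n hn n' hn' rfl
    exact hc.notMem_nbrs_of_good hdeg hgood hxy (hx n hn).1 (hy n hn').1
  simp only [List.mem_cons, List.not_mem_nil, or_false, forall_eq_or_imp, forall_eq]
    at hx hy hdisj
  obtain ⟨⟨-, hX₁, hH₁, d₁, d₁'⟩, -, hX₂, hH₂, d₂, d₂'⟩ := hx
  obtain ⟨⟨-, hX₃, hH₃, d₃, d₃'⟩, -, hX₄, hH₄, d₄, d₄'⟩ := hy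
  obtain ⟨⟨h₁₃, h₁₄⟩, h₂₃, h₂₄⟩ := hdisj
  have hE : TwoEdgeConn (H.filter fun e => ∀ v ∈ e, v ∈ X \ {x, y}).val (X \ {x, y}) :=
    .of_crossNum hc.loopless fun Z hZ hne hne' =>
      hgood Z _ (Finset.union_sdiff_of_subset hZ) Finset.disjoint_sdiff hne hne'
  have hNX : {n₁, n₂, n₃, n₄} ⊆ X \ {x, y} := by
    simp [Finset.insert_subset_iff, *]
  have hN : 4 ≤ ({n₁, n₂, n₃, n₄} : Finset V).card := by
    simp [Finset.card_insert_of_notMem, *]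
  refine (hE.exists_wheel hNX hN).hasW4Immersion (u := x) (P := P)
    (f := fun n => if n = n₁ then P s(x, n₁) else if n = n₂ then P s(x, n₂) else
      if n = n₃ then F₁ + P s(y, n₃) else F₂ + P s(y, n₄)) hE.mem
    hNX (Finset.sdiff_subset.trans h.sub) (h.sub (h.mem _ hxy x (by simp))) (by simp)
    (fun x y hxy => hP x y (Finset.mem_filter.mp (Finset.mem_val.mp hxy)).1) ?_ ?_
  · have t₁ := hP x n₁ hH₁
    have t₂ := hP x n₂ hH₂
    have t₃ : ∃ T, Trail x n₃ (F₁ + P s(y, n₃)) T := (hP y n₃ hH₃).imp' _ fun _ => hF₁.append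
    have t₄ : ∃ T, Trail x n₄ (F₂ + P s(y, n₄)) T := (hP y n₄ hH₄).imp' _ fun _ => hF₂.append
    simp [*, Ne.symm]
  · set K : Finset (Sym2 V) := {s(x, y), s(x, n₁), s(x, n₂), s(y, n₃), s(y, n₄)} with hK
    set Q := H.filter fun e => ∀ v ∈ e, v ∈ X \ {x, y} with hQ
    have hKH : K ⊆ H := by simp [Finset.insert_subset_iff, *]
    have hQK : ∀ e ∈ Q, e ∉ K := by
      intro e he heK
      have he' := (Finset.mem_filter.mp he).2
      simp only [hK, Finset.mem_insert, Finset.mem_singleton] at heK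
      rcases heK with rfl | rfl | rfl | rfl | rfl <;> simp at he'
    have hle := h.sum_le (P := fun e => if e = s(x, y) then F₁ + F₂ else P e) (Q := Q ∪ K)
      (Finset.union_subset (Finset.filter_subset _ _) hKH) fun e he => by
        split_ifs with hexy
        · rwa [hexy]
        · refine hPle e ?_
          rcases Finset.mem_union.mp he with he | he
          exacts [Finset.mem_of_mem_filter e he, hKH he]
    have hsumQ : ∑ e ∈ Q, (if e = s(x, y) then F₁ + F₂ else P e) = (Q.val.map P).sum :=
      Finset.sum_congr rfl fun e he =>
        if_neg fun hexy => hQK e he (by simp [hexy, hK])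
    have hsumK : ∑ e ∈ K, (if e = s(x, y) then F₁ + F₂ else P e) =
        F₁ + F₂ + (P s(x, n₁) + (P s(x, n₂) + (P s(y, n₃) + P s(y, n₄)))) := by
      rw [hK, Finset.sum_insert, Finset.sum_insert, Finset.sum_insert, Finset.sum_insert,
        Finset.sum_singleton]
      all_goals simp [*, Ne.symm]
    rw [Finset.sum_union (Finset.disjoint_left.mpr hQK), hsumQ, hsumK] at hle
    refine le_of_eq_of_le ?_ hle
    rw [Finset.sum_insert, Finset.sum_insert, Finset.sum_insert, Finset.sum_singleton]
    · simp only [if_true, h₁₂.symm, h₁₃.symm, h₂₃.symm, h₁₄.symm, h₂₄.symm, h₃₄.symm, if_false]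
      abel
    all_goals simp [*]

end Torso

namespace Torso

variable {G : MG V} {X : Finset V} {H : Finset (Sym2 V)} {π : V → Sym2 V}

/-- The vertices of `G` can be mapped to `X` so that cuts of `H` consisting of thin edges give
cuts of `G` of the same size. -/
theorem exists_retraction (h : Torso G X H π) : ∃ r : V → V, (∀ v ∈ X, r v = v) ∧
    (∀ v ∈ G.verts, r v ∈ X) ∧ ∀ Q ⊆ X, (∀ a ∈ Q, ∀ b ∉ Q, s(a, b) ∈ H → Thin G π s(a, b)) →
      dcut G (G.verts.filter fun v => r v ∈ Q) ≤ crossNum H Q (X \ Q) := by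
  have hρ : ∀ e : Sym2 V, ∃ ρ : V → V, (∀ v, ρ v ∈ e) ∧ (∀ v ∈ e, ρ v = v) ∧
      (Thin G π e → ((piece G π e).filter fun g => Sym2.map ρ g = e).card ≤ 1) := by
    intro e
    by_cases he : Thin G π e
    · obtain ⟨ρ, h₁, h₂, h₃⟩ := he
      exact ⟨ρ, h₁, h₂, fun _ => h₃⟩
    · refine ⟨fun v => if v ∈ e then v else e.out.1, fun v => ?_, fun v hv => if_pos hv,
        fun h => absurd h he⟩
      dsimp only
      split_ifs with hv
      · exact hv
      · exact Sym2.out_fst_mem e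
  choose ρ hρe hρs hρt using hρ
  set r : V → V := fun v => ρ (π v) v with hr
  have hrX : ∀ v ∈ X, r v = v := fun v hv => hρs _ v (by simp [h.proj_self v hv])
  have hrπ : ∀ v, r v ∈ π v := fun v => hρe _ v
  have hrmem : ∀ v ∈ G.verts, r v ∈ X := by
    intro v hv
    by_cases hvX : v ∈ X
    · rwa [hrX v hvX]
    · rcases h.proj v hv hvX with hH | ⟨a, ha, hπ⟩
      · exact h.mem _ hH _ (hrπ v)
      · have := hrπ v
        rw [hπ, Sym2.mem_iff, or_self] at this
        rwa [this]
  have hproj : ∀ v ∈ G.verts, v ∉ X → ∀ a ∈ π v, ∀ b ∈ π v, a ≠ b → s(a, b) ∈ H ∧ π v = s(a, b) := by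
    intro v hv hvX a ha b hb hab
    have hπ := (Sym2.mem_and_mem_iff hab).mp ⟨ha, hb⟩
    refine ⟨?_, hπ⟩
    rcases h.proj v hv hvX with hH | ⟨c, -, hc⟩
    · rwa [← hπ]
    · rw [hc, Sym2.mem_iff, or_self] at ha hb
      exact absurd (ha.trans hb.symm) hab
  have hedge : ∀ v w, s(v, w) ∈ G.edges → r v ≠ r w → s(r v, r w) ∈ H ∧
      s(v, w) ∈ piece G π s(r v, r w) ∧ Sym2.map (ρ s(r v, r w)) s(v, w) = s(r v, r w) := by
    have hone : ∀ v w, s(v, w) ∈ G.edges → r v ≠ r w → v ∉ X → w ∈ X → s(r v, r w) ∈ H ∧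
        s(v, w) ∈ piece G π s(r v, r w) ∧
        Sym2.map (ρ s(r v, r w)) s(v, w) = s(r v, r w) := by
      intro v w hvw hne hv hw
      have hwπ := h.adj_attach v w hvw hv hw
      rw [hrX w hw] at hne ⊢
      obtain ⟨hH, hπ⟩ := hproj v (G.edge_support _ hvw v (by simp)) hv _ (hrπ v) w hwπ hne
      refine ⟨hH, Multiset.mem_filter.mpr ⟨hvw, fun u hu => ?_⟩, ?_⟩
      · rcases Sym2.mem_iff.mp hu with rfl | rfl
        · exact .inr hπ
        · exact .inl (by simp)
      · rw [Sym2.map_mk, ← hπ, hρs (π v) w hwπ]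
        exact hπ.symm
    intro v w hvw hne
    by_cases hv : v ∈ X <;> by_cases hw : w ∈ X
    · rw [hrX v hv, hrX w hw]
      refine ⟨h.adj_mem v w hvw hv hw, Multiset.mem_filter.mpr ⟨hvw, fun u hu => .inl hu⟩, ?_⟩
      rw [Sym2.map_mk, hρs _ v (by simp), hρs _ w (by simp)]
    · have := hone w v (by rwa [Sym2.eq_swap]) hne.symm hw hv
      rwa [Sym2.eq_swap (a := r w), Sym2.eq_swap (a := w)] at this
    · exact hone v w hvw hne hv hw
    · have hπ := h.adj_eq v w hvw hv hw
      obtain ⟨hH, hπ'⟩ := hproj v (G.edge_support _ hvw v (by simp)) hv _ (hrπ v) (r w)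
        (hπ ▸ hrπ w) hne
      refine ⟨hH, Multiset.mem_filter.mpr ⟨hvw, fun u hu => .inr ?_⟩, ?_⟩
      · rcases Sym2.mem_iff.mp hu with rfl | rfl
        · exact hπ'
        · rw [← hπ, hπ']
      · rw [Sym2.map_mk, ← hπ', hπ', ← hπ']
        conv_lhs => rw [Sym2.eq_iff.mpr (.inl ⟨rfl, congrArg (fun e => ρ e w) hπ⟩)]
        exact hπ'.symm
  refine ⟨r, hrX, hrmem, fun Q hQ hthin => ?_⟩
  set F : Sym2 V → Multiset (Sym2 V) := fun e =>
    (piece G π e).filter fun g => Sym2.map (ρ e) g = e with hF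
  set K := H.filter fun e => ∃ x ∈ Q, ∃ y ∈ X \ Q, e = s(x, y) with hK
  have hle : cutEdges G (G.verts.filter fun v => r v ∈ Q) ≤ ∑ e ∈ K, F e := by
    rw [Multiset.le_iff_count]
    intro g
    by_cases hg : g ∈ cutEdges G (G.verts.filter fun v => r v ∈ Q)
    · obtain ⟨hgG, v, w, rfl, hv, hw⟩ := Multiset.mem_filter.mp hg
      rw [Finset.mem_filter] at hv hw
      have hwG := G.edge_support _ hgG w (by simp)
      have hwQ : r w ∉ Q := fun hwQ => hw ⟨hwG, hwQ⟩
      obtain ⟨hH, hpiece, hmap⟩ := hedge v w hgG fun hvw => hwQ (hvw ▸ hv.2)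
      have hcount : (F s(r v, r w)).count s(v, w) = G.edges.count s(v, w) :=
        (Multiset.count_filter_of_pos
          (p := fun g => Sym2.map (ρ s(r v, r w)) g = s(r v, r w)) hmap).trans
          (Multiset.count_filter_of_pos (Multiset.of_mem_filter hpiece))
      refine (Multiset.count_le_of_le _ (Multiset.filter_le _ _)).trans ?_
      rw [← hcount, Multiset.count_sum']
      refine Finset.single_le_sum (f := fun e => (F e).count s(v, w))
        (fun _ _ => Nat.zero_le _) ?_
      exact Finset.mem_filter.mpr ⟨hH, _, hv.2, _, Finset.mem_sdiff.mpr ⟨hrmem w hwG, hwQ⟩, rfl⟩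
    · rw [Multiset.count_eq_zero_of_notMem hg]
      exact Nat.zero_le _
  rw [← card_cross H Finset.disjoint_sdiff, dcut]
  refine (Multiset.card_le_card hle).trans ?_
  rw [Multiset.card_sum, Finset.card_eq_sum_ones]
  refine Finset.sum_le_sum fun e he => ?_
  obtain ⟨heH, a, ha, b, hb, rfl⟩ := Finset.mem_filter.mp he
  exact hρt _ (hthin a ha b (Finset.mem_sdiff.mp hb).2 heH)

theorem cubic_of_threeConn (h : Torso G X H π) (h3 : EdgeConn G 3) (h4 : InternallyEdgeConn G 4)
    (hno : ¬ HasW4Immersion G) (hc : ThreeConn X H) : Cubic G := by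
  have hfive := hc.five_le
  have hdeg : ∀ v ∈ X, (nbrs X H v).card = 3 := by
    intro v hv
    have hcard := Finset.le_card_sdiff {v} X
    rw [Finset.card_singleton] at hcard
    have hge := hc.three_le_cut (P := {v}) (by simpa using hv) (by simp)
      (Finset.card_pos.mp (by omega))
    rw [hc.crossNum_singleton] at hge
    by_contra hne
    exact hno (h.hasW4Immersion_of_four_nbrs hc hv (by omega))
  have hthin : ∀ x y, s(x, y) ∈ H → Good X H x y → Thin G π s(x, y) := by
    intro x y hxy hgood
    by_contra hthin
    exact hno (h.hasW4Immersion_of_good h3 hc hdeg hxy hgood hthin)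
  obtain ⟨r, hrX, hrG, hcut⟩ := h.exists_retraction
  have hsub : ∀ Q ⊆ X, Q ⊆ G.verts.filter (fun v => r v ∈ Q) ∧
      X \ Q ⊆ G.verts \ G.verts.filter (fun v => r v ∈ Q) := by
    refine fun Q hQ => ⟨fun v hv => ?_, fun v hv => ?_⟩
    · rw [Finset.mem_filter, hrX v (hQ hv)]
      exact ⟨h.sub (hQ hv), hv⟩
    · rw [Finset.mem_sdiff] at hv
      rw [Finset.mem_sdiff, Finset.mem_filter, hrX v hv.1]
      exact ⟨h.sub hv.1, fun h => hv.2 h.2⟩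
  have hgood : ∀ x y, s(x, y) ∈ H → Good X H x y := by
    intro x y hxy
    by_contra hbad
    obtain ⟨Q, hQX, hQ, hQ', hQ3⟩ := hc.exists_cut_of_not_good hdeg hxy hbad
    have hle := hcut Q hQX fun a ha b hb hab =>
      hthin a b hab (hc.good_of_cut hdeg hQX hQ hQ' hQ3 hab ha hb)
    have := h4 _ (Finset.filter_subset _ _) (hQ.trans (Finset.card_le_card (hsub Q hQX).1))
      (hQ'.trans (Finset.card_le_card (hsub Q hQX).2))
    omega
  intro v hv
  set Y := G.verts.filter fun w => r w ∈ ({r v} : Finset V) with hY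
  have hvX := hrG v hv
  have hvX' : {r v} ⊆ X := by simpa using hvX
  have hle := hcut {r v} hvX' fun a _ b _ hab => hthin a b hab (hgood a b hab)
  rw [hc.crossNum_singleton, hdeg _ hvX, ← hY] at hle
  have hcard := Finset.card_le_card (hsub {r v} hvX').2
  rw [← hY] at hcard
  have hcard' := Finset.le_card_sdiff {r v} X
  rw [Finset.card_singleton] at hcard'
  have hvY : v ∈ Y := by simp [hY, hv]
  have hYone : Y.card ≤ 1 := by
    by_contra! hlt
    have := h4 Y (Finset.filter_subset _ _) hlt (by omega)
    omega
  have hYv : Y = {v} := Finset.eq_singleton_iff_unique_mem.mpr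
    ⟨hvY, fun w hw => Finset.card_le_one.mp hYone w hw v hvY⟩
  have hge := h3 Y (Finset.filter_subset _ _) ⟨v, hvY⟩ fun hYG => by
    have := Finset.card_le_card h.sub
    rw [← hYG] at this
    omega
  rw [hYv] at hle
  rw [hYv] at hge
  have hdcut : dcut G {v} = deg G v := by
    rw [dcut, deg, cutEdges]
    congr 1
    refine Multiset.filter_congr fun e he => ⟨?_, fun hve => ?_⟩
    · rintro ⟨a, b, rfl, ha, -⟩
      simp [Finset.mem_singleton.mp ha]
    · obtain ⟨w, rfl⟩ := hve
      have : v ≠ w := by simpa using G.loopless _ he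
      exact ⟨v, w, rfl, by simp, by simpa using this.symm⟩
  omega

end Torso

/-- Let `G` be a `3`-edge-connected and internally `4`-edge-connected
graph which does not immerse `W₄`. Then either `G` is cubic or `G` has tree-width
at most `3`. -/
theorem statement_1 {V : Type} (G : MG V)
    (h3 : EdgeConn G 3) (h4 : InternallyEdgeConn G 4)
    (hno : ¬ HasW4Immersion G) :
    Cubic G ∨ treewidth G ≤ 3 := by
  by_cases hG : Cubic G
  · exact .inl hG
  refine .inr (HasDecomp.treewidth_le ?_)
  have := Torso.hasDecomp (G := G)
    (fun X H π h hX hsep => hG (h.cubic_of_threeConn h3 h4 hno ⟨h.mem, h.loopless, hX, hsep⟩))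
    _ _ _ _ rfl (Torso.refl G)
  simpa using this

end PaperW4
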